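/- arXiv:1404.5722 — 2 statements merged into one kernel-verified Lean document; each statement's English description precedes it below -/
import Mathlib

section
/- Let n ≥ 3 be odd and let t be an integer with t > 1. Then among the degrees d_1,…,d_{n−2} of any hsop of I_n, at least ⌊(n−1)/t⌋ are divisible by 2t; moreover all the degrees d_k are even. -/
set_option synthInstance.maxHeartbeats 1000000
noncomputable section

open MvPolynomial

/-- The binary form of degree `n` with coefficient vector `a`, as a polynomial in two
variables `X 0 = x`, `X 1 = y`. -/
def formPoly (n : ℕ) (a : Fin (n+1) → ℂ) : MvPolynomial (Fin 2) ℂ :=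
  ∑ i : Fin (n+1), C (a i) * X 0 ^ (n - (i : ℕ)) * X 1 ^ (i : ℕ)

/-- The action of `SL(2,ℂ)` on coefficient vectors of binary forms of degree `n`,
given by linear substitution of the variables `x`, `y`. -/
def sl2Act (n : ℕ) (g : Matrix.SpecialLinearGroup (Fin 2) ℂ) (a : Fin (n+1) → ℂ) :
    Fin (n+1) → ℂ := fun i =>
  coeff (Finsupp.single 0 (n - (i : ℕ)) + Finsupp.single 1 (i : ℕ))
    (bind₁ (fun j : Fin 2 => C (g.1 j 0) * X 0 + C (g.1 j 1) * X 1) (formPoly n a))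

/-- The ring of invariants `I_n` of the binary form of degree `n`: the subalgebra of
`ℂ[a_0,…,a_n]` of polynomials invariant under the `SL(2,ℂ)`-action. -/
def invariantRing (n : ℕ) : Subalgebra ℂ (MvPolynomial (Fin (n+1)) ℂ) where
  carrier := {p | ∀ g : Matrix.SpecialLinearGroup (Fin 2) ℂ, ∀ a : Fin (n+1) → ℂ,
    eval (sl2Act n g a) p = eval a p}
  mul_mem' := by
    intro p q hp hq g a
    simp only [Set.mem_setOf_eq, map_mul] at *
    rw [hp g a, hq g a]
  add_mem' := by
    intro p q hp hq g a
    simp only [Set.mem_setOf_eq, map_add] at *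
    rw [hp g a, hq g a]
  algebraMap_mem' := by
    intro c g a
    simp

/-- `IsHSOP n d p` says that `p` is a homogeneous system of parameters of the invariant
ring of the binary form of degree `n`, with degree sequence `d` : the `p k` are
homogeneous of positive degrees `d k`, algebraically independent over `ℂ`, and `I_n` is a
finitely generated module over the subalgebra they generate. -/
def IsHSOP (n : ℕ) (d : Fin (n-2) → ℕ) (p : Fin (n-2) → invariantRing n) : Prop :=
  (∀ k, 0 < d k) ∧
  (∀ k, ((p k : MvPolynomial (Fin (n+1)) ℂ)).IsHomogeneous (d k)) ∧
  AlgebraicIndependent ℂ p ∧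
  Module.Finite (Algebra.adjoin ℂ (Set.range p)) (invariantRing n)

/-- The coefficient of `x^(card ι - k) y^k` in the product of the linear forms `b i x + c i y`. -/
def binCoeff {ι R : Type*} [Fintype ι] [DecidableEq ι] [CommRing R] (b c : ι → R) (k : ℕ) : R :=
  ∑ s ∈ Finset.powersetCard k Finset.univ, (∏ i ∈ s, c i) * ∏ i ∈ sᶜ, b i

section BinCoeff

variable {ι R S : Type*} [Fintype ι] [DecidableEq ι] [CommRing R] [CommRing S]

theorem prod_linear_eq_sum_binCoeff (b c : ι → R) (u v : R) :
    ∏ i, (b i * u + c i * v) =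
      ∑ k ∈ Finset.range (Fintype.card ι + 1),
        binCoeff b c k * u ^ (Fintype.card ι - k) * v ^ k := by
  have h1 : ∏ i, (b i * u + c i * v) = ∏ i, (c i * v + b i * u) :=
    Finset.prod_congr rfl fun i _ => add_comm _ _
  rw [h1, Finset.prod_add, Finset.sum_powerset]
  refine Finset.sum_congr rfl fun k _ => ?_
  rw [binCoeff, Finset.sum_mul, Finset.sum_mul]
  refine Finset.sum_congr rfl fun s hs => ?_
  have hs' : s.card = k := (Finset.mem_powersetCard.1 hs).2
  rw [Finset.prod_mul_distrib, Finset.prod_mul_distrib, Finset.prod_const, Finset.prod_const,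
    ← Finset.compl_eq_univ_sdiff, Finset.card_compl, hs']
  ring

theorem map_binCoeff {F : Type*} [FunLike F R S] [RingHomClass F R S] (f : F) (b c : ι → R)
    (k : ℕ) : f (binCoeff b c k) = binCoeff (fun i => f (b i)) (fun i => f (c i)) k := by
  simp [binCoeff, map_sum, map_mul, map_prod]

theorem binCoeff_swap (b c : ι → R) {k : ℕ} (hk : k ≤ Fintype.card ι) :
    binCoeff c b k = binCoeff b c (Fintype.card ι - k) := by
  unfold binCoeff
  refine Finset.sum_bij' (fun s _ => sᶜ) (fun s _ => sᶜ) ?_ ?_ ?_ ?_ ?_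
  · intro s hs
    simp only [Finset.mem_powersetCard, Finset.subset_univ, true_and] at hs ⊢
    rw [Finset.card_compl, hs]
  · intro s hs
    simp only [Finset.mem_powersetCard, Finset.subset_univ, true_and] at hs ⊢
    rw [Finset.card_compl, hs]
    omega
  · simp
  · simp
  · intro s _
    rw [compl_compl, mul_comm]

theorem binCoeff_zero_right (b c : ι → R) : binCoeff b c 0 = ∏ i, b i := by
  simp [binCoeff]

theorem binCoeff_mul (l b c : ι → R) (k : ℕ) :
    binCoeff (l * b) (l * c) k = (∏ i, l i) * binCoeff b c k := by
  unfold binCoeff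
  rw [Finset.mul_sum]
  refine Finset.sum_congr rfl fun s _ => ?_
  simp only [Pi.mul_apply, Finset.prod_mul_distrib]
  rw [← Finset.prod_mul_prod_compl s l]
  ring

theorem binCoeff_one_left [Algebra R S] (c : ι → S) (k : ℕ) :
    binCoeff 1 c k = aeval c (esymm ι R k) := by
  simp [binCoeff, esymm, map_sum, map_prod]

theorem binCoeff_comp_equiv {κ : Type*} [Fintype κ] [DecidableEq κ] (e : κ ≃ ι) (b c : ι → R)
    (k : ℕ) : binCoeff (b ∘ e) (c ∘ e) k = binCoeff b c k := by
  unfold binCoeff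
  refine Finset.sum_bij' (fun s _ => s.map e.toEmbedding) (fun s _ => s.map e.symm.toEmbedding)
    ?_ ?_ ?_ ?_ ?_
  · intro s hs
    simpa [Finset.mem_powersetCard] using hs
  · intro s hs
    simpa [Finset.mem_powersetCard] using hs
  · intro s _
    ext x
    simp
  · intro s _
    ext x
    simp
  · intro s _
    have h : (s.map e.toEmbedding)ᶜ = sᶜ.map e.toEmbedding := by
      ext x
      simp
    rw [h]
    simp

theorem binCoeff_mul_right (z : R) (b c : ι → R) (k : ℕ) :
    binCoeff b (fun i => z * c i) k = z ^ k * binCoeff b c k := by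
  unfold binCoeff
  rw [Finset.mul_sum]
  refine Finset.sum_congr rfl fun s hs => ?_
  rw [Finset.prod_mul_distrib, Finset.prod_const, (Finset.mem_powersetCard.1 hs).2, mul_assoc]

end BinCoeff

theorem exists_eq_prod_linear (n : ℕ) (g : Polynomial ℂ) (hg : g.natDegree ≤ n + 1) :
    ∃ b c : Fin (n + 1) → ℂ,
      g = ∏ i, (Polynomial.C (b i) + Polynomial.C (c i) * Polynomial.X) := by
  induction n generalizing g with
  | zero =>
    refine ⟨fun _ => g.coeff 0, fun _ => g.coeff 1, ?_⟩
    rw [Fin.prod_univ_one]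
    rw [add_comm]
    exact Polynomial.eq_X_add_C_of_natDegree_le_one hg
  | succ n ih =>
    by_cases h : g.natDegree ≤ n + 1
    · obtain ⟨b, c, hbc⟩ := ih g h
      refine ⟨Fin.cons 1 b, Fin.cons 0 c, ?_⟩
      rw [Fin.prod_univ_succ]
      simpa using hbc
    · have hd : g.degree ≠ 0 := by
        intro h0
        exact h (by simp [Polynomial.natDegree_eq_zero_iff_degree_le_zero.2 h0.le])
      obtain ⟨ρ, hρ⟩ := IsAlgClosed.exists_root g hd
      obtain ⟨q, hq⟩ := Polynomial.dvd_iff_isRoot.2 hρ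
      have hq0 : q ≠ 0 := by
        rintro rfl
        simp [hq] at h
      have hdeg : g.natDegree = 1 + q.natDegree := by
        rw [hq, Polynomial.natDegree_mul (Polynomial.X_sub_C_ne_zero ρ) hq0,
          Polynomial.natDegree_X_sub_C]
      obtain ⟨b, c, hbc⟩ := ih q (by omega)
      refine ⟨Fin.cons (-ρ) b, Fin.cons 1 c, ?_⟩
      rw [Fin.prod_univ_succ]
      simp only [Fin.cons_zero, Fin.cons_succ]
      rw [← hbc, hq]
      simp only [map_neg, map_one]
      ring

theorem exists_binCoeff_eq {ι : Type*} [Fintype ι] [DecidableEq ι] {n : ℕ}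
    (hn : Fintype.card ι = n) (hpos : 0 < n) (a : Fin (n + 1) → ℂ) :
    ∃ b c : ι → ℂ, (fun k : Fin (n + 1) => binCoeff b c k) = a := by
  obtain ⟨m, rfl⟩ : ∃ m, n = m + 1 := ⟨n - 1, by omega⟩
  let g : Polynomial ℂ := ∑ k : Fin (m + 1 + 1), Polynomial.monomial k (a k)
  have hg : g.natDegree ≤ m + 1 := by
    refine Polynomial.natDegree_sum_le_of_forall_le _ _ fun k _ => ?_
    exact (Polynomial.natDegree_monomial_le _).trans (by omega)
  obtain ⟨b, c, hbc⟩ := exists_eq_prod_linear m g hg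
  let e : ι ≃ Fin (m + 1) := Fintype.equivFinOfCardEq hn
  refine ⟨b ∘ e, c ∘ e, funext fun k => ?_⟩
  rw [binCoeff_comp_equiv]
  have h1 : g.coeff k = a k := by
    simp only [g, Polynomial.finsetSum_coeff, Polynomial.coeff_monomial]
    simp [Fin.val_inj]
  have h2 := prod_linear_eq_sum_binCoeff (fun i => Polynomial.C (b i)) (fun i => Polynomial.C (c i))
    1 Polynomial.X
  simp only [mul_one, one_pow, ← map_binCoeff] at h2
  rw [← hbc] at h2
  rw [← h1, h2]
  simp only [Polynomial.finsetSum_coeff, Polynomial.coeff_C_mul_X_pow]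
  rw [Finset.sum_ite_eq]
  simp [k.2]

theorem sl2Act_binCoeff {ι : Type*} [Fintype ι] [DecidableEq ι] {n : ℕ}
    (hn : Fintype.card ι = n) (g : Matrix.SpecialLinearGroup (Fin 2) ℂ) (b c : ι → ℂ) :
    sl2Act n g (fun k => binCoeff b c k) = fun k : Fin (n + 1) =>
      binCoeff (fun i => b i * g.1 0 0 + c i * g.1 1 0) (fun i => b i * g.1 0 1 + c i * g.1 1 1)
        k := by
  have expand : ∀ {σ : Type} (u v : MvPolynomial σ ℂ) (b c : ι → ℂ),
      ∏ i, (C (b i) * u + C (c i) * v) =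
        ∑ k : Fin (n + 1), C (binCoeff b c k) * u ^ (n - (k : ℕ)) * v ^ (k : ℕ) := by
    intro σ u v b c
    rw [prod_linear_eq_sum_binCoeff, hn, Finset.sum_range]
    simp only [← map_binCoeff]
  have key : formPoly n (fun k => binCoeff b c k) = ∏ i, (C (b i) * X 0 + C (c i) * X 1) :=
    (expand _ _ b c).symm
  suffices aux : ∀ (M : Fin 2 → Fin 2 → ℂ) (k : Fin (n + 1)),
      coeff (Finsupp.single (0 : ℕ) (n - (k : ℕ)) + Finsupp.single 1 (k : ℕ))
        (bind₁ (fun j : Fin 2 => C (M j 0) * X 0 + C (M j 1) * X 1)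
          (formPoly n fun k => binCoeff b c k)) =
        binCoeff (fun i => b i * M 0 0 + c i * M 1 0) (fun i => b i * M 0 1 + c i * M 1 1) k from
    funext fun k => aux g.1 k
  intro M k
  rw [key, map_prod]
  have h : ∀ i, bind₁ (fun j : Fin 2 => C (M j 0) * X 0 + C (M j 1) * X 1)
      (C (b i) * X 0 + C (c i) * X 1 : MvPolynomial (Fin 2) ℂ) =
      C (b i * M 0 0 + c i * M 1 0) * X 0 +
        C (b i * M 0 1 + c i * M 1 1) * (X 1 : MvPolynomial ℕ ℂ) := by
    intro i
    simp only [map_add, map_mul, bind₁_X_right, algHom_C, algebraMap_eq]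
    ring
  rw [Finset.prod_congr rfl fun i _ => h i, expand, coeff_sum, Finset.sum_eq_single k]
  · rw [mul_assoc, coeff_C_mul]
    have : (X 0 ^ (n - (k : ℕ)) * X 1 ^ (k : ℕ) : MvPolynomial ℕ ℂ) =
        monomial (Finsupp.single 0 (n - (k : ℕ)) + Finsupp.single 1 (k : ℕ)) 1 := by
      simp [X_pow_eq_monomial, monomial_mul]
    rw [this, coeff_monomial, if_pos rfl, mul_one]
  · intro l _ hl
    rw [mul_assoc, coeff_C_mul]
    have : (X 0 ^ (n - (l : ℕ)) * X 1 ^ (l : ℕ) : MvPolynomial ℕ ℂ) =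
        monomial (Finsupp.single 0 (n - (l : ℕ)) + Finsupp.single 1 (l : ℕ)) 1 := by
      simp [X_pow_eq_monomial, monomial_mul]
    rw [this, coeff_monomial, if_neg, mul_zero]
    intro h
    have := DFunLike.congr_fun h 1
    simp at this
    omega
  · simp

theorem exists_homogenization {ι : Type*} [Fintype ι] [DecidableEq ι] {n : ℕ}
    (P : MvPolynomial (Fin n) ℂ) :
    ∃ (m : ℕ) (H : MvPolynomial (Fin (n + 1)) ℂ), ∀ (z : ℂ) (c : ι → ℂ),
      eval (fun k : Fin (n + 1) => z * binCoeff 1 c k) H =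
        z ^ m * eval (fun k : Fin n => binCoeff 1 c (k + 1)) P := by
  have h0 : ∀ c : ι → ℂ, binCoeff 1 c 0 = 1 := fun c => by simp [binCoeff_zero_right]
  induction P using MvPolynomial.induction_on with
  | C a => exact ⟨0, C a, by simp⟩
  | add p q hp hq =>
    obtain ⟨m₁, H₁, h₁⟩ := hp
    obtain ⟨m₂, H₂, h₂⟩ := hq
    refine ⟨m₁ + m₂, X 0 ^ m₂ * H₁ + X 0 ^ m₁ * H₂, fun z c => ?_⟩
    simp only [map_add, map_mul, map_pow, eval_X, h₁, h₂, Fin.val_zero, h0]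
    ring
  | mul_X p k hp =>
    obtain ⟨m, H, h⟩ := hp
    refine ⟨m + 1, H * X k.succ, fun z c => ?_⟩
    simp only [map_mul, eval_X, h, Fin.val_succ]
    ring

section Descent

variable {ι : Type*} [Fintype ι] [DecidableEq ι] {n : ℕ}

theorem exists_descent_left (hn : Fintype.card ι = n) (d : ℕ) (B : MvPolynomial (ι ⊕ ι) ℂ)
    (hsymm : ∀ (σ : Equiv.Perm ι) (b c : ι → ℂ),
      eval (Sum.elim (b ∘ σ) (c ∘ σ)) B = eval (Sum.elim b c) B)
    (hhom : ∀ l b c : ι → ℂ,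
      eval (Sum.elim (l * b) (l * c)) B = (∏ i, l i) ^ d * eval (Sum.elim b c) B) :
    ∃ (m : ℕ) (H : MvPolynomial (Fin (n + 1)) ℂ), ∀ b c : ι → ℂ,
      eval (fun k : Fin (n + 1) => binCoeff b c k) H = (∏ i, b i) ^ m * eval (Sum.elim b c) B := by
  let S : MvPolynomial ι ℂ := aeval (Sum.elim 1 X) B
  have hS : ∀ c : ι → ℂ, eval c S = eval (Sum.elim 1 c) B := by
    intro c
    have : (aeval c : MvPolynomial ι ℂ →ₐ[ℂ] ℂ).comp (aeval (Sum.elim 1 X)) =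
        (aeval (Sum.elim 1 c) : MvPolynomial (ι ⊕ ι) ℂ →ₐ[ℂ] ℂ) := by
      ext i
      rcases i with i | i <;> simp
    exact DFunLike.congr_fun this B
  have hSs : S.IsSymmetric := by
    intro σ
    refine MvPolynomial.funext fun c => ?_
    rw [eval_rename, hS, hS]
    exact hsymm σ 1 c
  obtain ⟨P, hP⟩ := esymmAlgHom_surjective (σ := ι) ℂ hn.le ⟨S, hSs⟩
  have hP' : aeval (fun k : Fin n => esymm ι ℂ (k + 1)) P = S := by
    rw [← esymmAlgHom_apply, hP]
  have hPe : ∀ c : ι → ℂ, eval (fun k : Fin n => binCoeff 1 c (k + 1)) P = eval c S := by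
    intro c
    rw [← hP', ← coe_aeval_eq_eval, ← coe_aeval_eq_eval]
    have : (aeval c : MvPolynomial ι ℂ →ₐ[ℂ] ℂ).comp
        (aeval (fun k : Fin n => esymm ι ℂ (k + 1))) =
        (aeval (fun k : Fin n => binCoeff 1 c (k + 1)) : MvPolynomial (Fin n) ℂ →ₐ[ℂ] ℂ) := by
      ext k
      simp [binCoeff_one_left (R := ℂ)]
    exact (DFunLike.congr_fun this P).symm
  obtain ⟨m, H, hH⟩ := exists_homogenization (ι := ι) P
  have hne : ∀ b c : ι → ℂ, (∀ i, b i ≠ 0) →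
      (∏ i, b i) ^ d * eval (fun k : Fin (n + 1) => binCoeff b c k) H =
        (∏ i, b i) ^ m * eval (Sum.elim b c) B := by
    intro b c hb
    have h1 : b * 1 = b := mul_one b
    have h2 : b * (fun i => c i / b i) = c := by
      funext i
      simp [mul_div_cancel₀ _ (hb i)]
    have h3 := hhom b 1 fun i => c i / b i
    have h4 := hH (∏ i, b i) fun i => c i / b i
    simp only [← binCoeff_mul] at h4
    rw [h1, h2] at h3
    rw [h1, h2, hPe, hS] at h4
    rw [h3, h4]
    ring
  refine ⟨m, X 0 ^ d * H, fun b c => ?_⟩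
  let bX : ι → MvPolynomial (ι ⊕ ι) ℂ := fun i => X (Sum.inl i)
  let cX : ι → MvPolynomial (ι ⊕ ι) ℂ := fun i => X (Sum.inr i)
  have hpoly : (∏ i, bX i) * aeval (fun k : Fin (n + 1) => binCoeff bX cX k) (X 0 ^ d * H) =
      (∏ i, bX i) * ((∏ i, bX i) ^ m * B) := by
    refine MvPolynomial.funext fun x => ?_
    have hx : ∀ Q : MvPolynomial (Fin (n + 1)) ℂ,
        eval x (aeval (fun k : Fin (n + 1) => binCoeff bX cX k) Q) =
        eval (fun k : Fin (n + 1) => binCoeff (x ∘ Sum.inl) (x ∘ Sum.inr) k) Q := by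
      intro Q
      have : (aeval x : MvPolynomial (ι ⊕ ι) ℂ →ₐ[ℂ] ℂ).comp
          (aeval (fun k : Fin (n + 1) => binCoeff bX cX k)) =
          aeval (fun k : Fin (n + 1) => binCoeff (x ∘ Sum.inl) (x ∘ Sum.inr) k) := by
        ext k
        simp [map_binCoeff, bX, cX, Function.comp_def]
      exact DFunLike.congr_fun this Q
    simp only [map_mul, map_prod, map_pow, hx, eval_X, bX, Fin.val_zero, binCoeff_zero_right]
    by_cases h : ∀ i, x (Sum.inl i) ≠ 0
    · have := hne (x ∘ Sum.inl) (x ∘ Sum.inr) h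
      rw [Sum.elim_comp_inl_inr] at this
      simp only [Function.comp_apply] at this ⊢
      rw [this]
    · push Not at h
      obtain ⟨i, hi⟩ := h
      rw [Finset.prod_eq_zero (Finset.mem_univ i) hi, zero_mul, zero_mul]
  have hcancel := mul_left_cancel₀ (Finset.prod_ne_zero_iff.2 fun i _ => X_ne_zero _) hpoly
  have h := congrArg (aeval (Sum.elim b c) : MvPolynomial (ι ⊕ ι) ℂ →ₐ[ℂ] ℂ) hcancel
  have hcomp : (aeval (Sum.elim b c) : MvPolynomial (ι ⊕ ι) ℂ →ₐ[ℂ] ℂ).comp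
      (aeval (fun k : Fin (n + 1) => binCoeff bX cX k)) =
      aeval (fun k : Fin (n + 1) => binCoeff b c k) := by
    ext k
    simp [map_binCoeff, bX, cX]
  rw [← AlgHom.comp_apply, hcomp] at h
  simpa [bX] using h

/-- A symmetric multihomogeneous polynomial function of the linear factors of a binary form is a
polynomial in the coefficients of the form. -/
theorem exists_descent (hn : Fintype.card ι = n) (hpos : 0 < n) (d : ℕ)
    (B : MvPolynomial (ι ⊕ ι) ℂ)
    (hsymm : ∀ (σ : Equiv.Perm ι) (b c : ι → ℂ),
      eval (Sum.elim (b ∘ σ) (c ∘ σ)) B = eval (Sum.elim b c) B)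
    (hhom : ∀ l b c : ι → ℂ,
      eval (Sum.elim (l * b) (l * c)) B = (∏ i, l i) ^ d * eval (Sum.elim b c) B) :
    ∃ H : MvPolynomial (Fin (n + 1)) ℂ,
      aeval (fun k : Fin (n + 1) => binCoeff (fun i => X (Sum.inl i)) (fun i => X (Sum.inr i)) k) H
        = B := by
  obtain ⟨m₁, H₁, h₁⟩ := exists_descent_left hn d B hsymm hhom
  have hswap : ∀ b c : ι → ℂ, eval (Sum.elim b c) (rename Sum.swap B) =
      eval (Sum.elim c b) B := by
    intro b c
    rw [eval_rename]
    congr 2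
    funext i
    rcases i with i | i <;> rfl
  obtain ⟨m₂, H₂, h₂⟩ := exists_descent_left hn d (rename Sum.swap B)
    (fun σ b c => by rw [hswap, hswap, hsymm]) (fun l b c => by rw [hswap, hswap, hhom])
  have hrev : ∀ b c : ι → ℂ, eval (fun k : Fin (n + 1) => binCoeff b c k) (rename Fin.rev H₂) =
      binCoeff b c n ^ m₂ * eval (Sum.elim b c) B := by
    intro b c
    have h := h₂ c b
    rw [hswap, ← binCoeff_zero_right c b, binCoeff_swap _ _ (Nat.zero_le _), Nat.sub_zero, hn] at h
    rw [eval_rename, ← h]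
    congr 2
    funext k
    rw [binCoeff_swap b c (hn.symm ▸ Nat.lt_succ_iff.1 k.2), hn, Function.comp_apply, Fin.val_rev]
    congr 1
    omega
  have hmul : X (Fin.last n) ^ m₂ * H₁ = X 0 ^ m₁ * rename Fin.rev H₂ := by
    refine MvPolynomial.funext fun a => ?_
    obtain ⟨b, c, rfl⟩ := exists_binCoeff_eq hn hpos a
    simp only [map_mul, map_pow, eval_X, h₁, hrev, Fin.val_zero, Fin.val_last,
      binCoeff_zero_right]
    ring
  have hndvd : ¬ (X 0 : MvPolynomial (Fin (n + 1)) ℂ) ∣ X (Fin.last n) ^ m₂ := by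
    intro h
    have h' := (MvPolynomial.X_prime (R := ℂ) (i := (0 : Fin (n + 1)))).dvd_of_dvd_pow h
    rw [X_dvd_X] at h'
    have := congrArg Fin.val h'
    simp at this
    omega
  obtain ⟨H, hH⟩ :=
    (MvPolynomial.X_prime (R := ℂ) (i := (0 : Fin (n + 1)))).pow_dvd_of_dvd_mul_left m₁
      hndvd (Dvd.intro _ hmul.symm)
  refine ⟨H, ?_⟩
  have hne : (∏ i : ι, X (Sum.inl i) : MvPolynomial (ι ⊕ ι) ℂ) ^ m₁ ≠ 0 :=
    pow_ne_zero _ (Finset.prod_ne_zero_iff.2 fun i _ => X_ne_zero _)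
  refine mul_left_cancel₀ hne (MvPolynomial.funext fun x => ?_)
  have hx : ∀ Q : MvPolynomial (Fin (n + 1)) ℂ,
      eval x (aeval (fun k : Fin (n + 1) =>
        binCoeff (fun i : ι => X (Sum.inl i)) (fun i : ι => X (Sum.inr i)) k) Q) =
      eval (fun k : Fin (n + 1) => binCoeff (x ∘ Sum.inl) (x ∘ Sum.inr) k) Q := by
    intro Q
    have : (aeval x : MvPolynomial (ι ⊕ ι) ℂ →ₐ[ℂ] ℂ).comp
        (aeval (fun k : Fin (n + 1) =>
          binCoeff (fun i : ι => X (Sum.inl i)) (fun i : ι => X (Sum.inr i)) k)) =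
        aeval (fun k : Fin (n + 1) => binCoeff (x ∘ Sum.inl) (x ∘ Sum.inr) k) := by
      ext k
      simp [map_binCoeff, Function.comp_def]
    exact DFunLike.congr_fun this Q
  have h := h₁ (x ∘ Sum.inl) (x ∘ Sum.inr)
  rw [hH, Sum.elim_comp_inl_inr] at h
  simp only [map_mul, map_pow, eval_X, Fin.val_zero, binCoeff_zero_right,
    Function.comp_apply] at h
  rw [map_mul, map_mul, hx, map_pow, map_prod]
  simp only [eval_X]
  exact h

/-- A symmetric multihomogeneous `SL(2)`-invariant polynomial function of the linear factors of a
binary form is given by an invariant of the form. -/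
theorem exists_invariant_of_symmetric (hn : Fintype.card ι = n) (hpos : 0 < n) (d : ℕ)
    (B : MvPolynomial (ι ⊕ ι) ℂ)
    (hsymm : ∀ (σ : Equiv.Perm ι) (b c : ι → ℂ),
      eval (Sum.elim (b ∘ σ) (c ∘ σ)) B = eval (Sum.elim b c) B)
    (hhom : ∀ l b c : ι → ℂ,
      eval (Sum.elim (l * b) (l * c)) B = (∏ i, l i) ^ d * eval (Sum.elim b c) B)
    (hinv : ∀ (g : Matrix.SpecialLinearGroup (Fin 2) ℂ) (b c : ι → ℂ),
      eval (Sum.elim (fun i => b i * g.1 0 0 + c i * g.1 1 0)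
        (fun i => b i * g.1 0 1 + c i * g.1 1 1)) B = eval (Sum.elim b c) B) :
    ∃ H ∈ invariantRing n, ∀ {K : Type} [CommRing K] [Algebra ℂ K] (b c : ι → K),
      aeval (fun k : Fin (n + 1) => binCoeff b c k) H = aeval (Sum.elim b c) B := by
  obtain ⟨H, hH⟩ := exists_descent hn hpos d B hsymm hhom
  have hval : ∀ {K : Type} [CommRing K] [Algebra ℂ K] (b c : ι → K),
      aeval (fun k : Fin (n + 1) => binCoeff b c k) H = aeval (Sum.elim b c) B := by
    intro K _ _ b c
    have : (aeval (Sum.elim b c) : MvPolynomial (ι ⊕ ι) ℂ →ₐ[ℂ] K).comp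
        (aeval (fun k : Fin (n + 1) =>
          binCoeff (fun i : ι => X (Sum.inl i)) (fun i : ι => X (Sum.inr i)) k)) =
        aeval (fun k : Fin (n + 1) => binCoeff b c k) := by
      ext k
      simp [map_binCoeff]
    rw [← hH, ← AlgHom.comp_apply, this]
  refine ⟨H, fun g a => ?_, hval⟩
  obtain ⟨b, c, rfl⟩ := exists_binCoeff_eq hn hpos a
  rw [sl2Act_binCoeff hn]
  have h₁ := hval (fun i => b i * g.1 0 0 + c i * g.1 1 0) (fun i => b i * g.1 0 1 + c i * g.1 1 1)
  have h₂ := hval b c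
  exact h₁.trans ((hinv g b c).trans h₂.symm)

end Descent

/-- The bracket of the linear forms `b i x + c i y` and `b j x + c j y`. -/
def bracket {ι R : Type*} [CommRing R] (b c : ι → R) (i j : ι) : R := b i * c j - b j * c i

/-- The bracket monomial of the directed multigraph on `ι` with `e i j` edges from `i` to `j`. -/
def bracketProd {ι R : Type*} [Fintype ι] [CommRing R] (e : ι → ι → ℕ) (b c : ι → R) : R :=
  ∏ i, ∏ j, bracket b c i j ^ e i j

/-- The valency of a vertex in a directed multigraph. -/
def valency {ι : Type*} [Fintype ι] (e : ι → ι → ℕ) (i : ι) : ℕ := ∑ j, (e i j + e j i)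

/-- The directed multigraph with a single edge. -/
def edge {ι : Type*} [DecidableEq ι] (a a' : ι) : ι → ι → ℕ := Pi.single a (Pi.single a' 1)

theorem edge_apply {ι : Type*} [DecidableEq ι] (a a' x y : ι) :
    edge a a' x y = if x = a ∧ y = a' then 1 else 0 := by
  unfold edge
  by_cases hx : x = a
  · subst hx
    simp [Pi.single_apply]
  · simp [hx]

section BracketProd

variable {ι R S : Type*} [Fintype ι] [CommRing R] [CommRing S]

theorem map_bracketProd {F : Type*} [FunLike F R S] [RingHomClass F R S] (f : F)
    (e : ι → ι → ℕ) (b c : ι → R) :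
    f (bracketProd e b c) = bracketProd e (fun i => f (b i)) (fun i => f (c i)) := by
  simp [bracketProd, bracket, map_prod, map_pow, map_sub, map_mul]

theorem bracketProd_mul {e : ι → ι → ℕ} {d : ℕ} (he : ∀ i, valency e i = d) (l b c : ι → R) :
    bracketProd e (l * b) (l * c) = (∏ i, l i) ^ d * bracketProd e b c := by
  have h : ∀ i j, bracket (l * b) (l * c) i j ^ e i j =
      l i ^ e i j * l j ^ e i j * bracket b c i j ^ e i j := by
    intro i j
    rw [← mul_pow, ← mul_pow]
    congr 1
    simp only [bracket, Pi.mul_apply]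
    ring
  unfold bracketProd
  simp only [h, Finset.prod_mul_distrib]
  congr 1
  rw [Finset.prod_comm (f := fun i j => l j ^ e i j), ← Finset.prod_mul_distrib, ← Finset.prod_pow]
  refine Finset.prod_congr rfl fun i _ => ?_
  rw [Finset.prod_pow_eq_pow_sum, Finset.prod_pow_eq_pow_sum, ← pow_add, ← Finset.sum_add_distrib]
  congr 1
  exact he i

theorem bracketProd_add (e e' : ι → ι → ℕ) (b c : ι → R) :
    bracketProd (e + e') b c = bracketProd e b c * bracketProd e' b c := by
  simp [bracketProd, pow_add, Finset.prod_mul_distrib]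

theorem bracketProd_edge [DecidableEq ι] (a a' : ι) (b c : ι → R) :
    bracketProd (edge a a') b c = bracket b c a a' := by
  unfold bracketProd edge
  rw [Finset.prod_eq_single a, Finset.prod_eq_single a']
  · simp
  · intro j _ hj
    simp [hj]
  · simp
  · intro i _ hi
    simp [hi]
  · simp

theorem bracketProd_ne_zero [IsDomain R] {e : ι → ι → ℕ} {b c : ι → R}
    (h : ∀ i j, e i j ≠ 0 → bracket b c i j ≠ 0) : bracketProd e b c ≠ 0 := by
  refine Finset.prod_ne_zero_iff.2 fun i _ => Finset.prod_ne_zero_iff.2 fun j _ => ?_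
  by_cases he : e i j = 0
  · simp [he]
  · exact pow_ne_zero _ (h i j he)

theorem valency_add (e e' : ι → ι → ℕ) (i : ι) :
    valency (e + e') i = valency e i + valency e' i := by
  simp only [valency, Pi.add_apply, ← Finset.sum_add_distrib]
  exact Finset.sum_congr rfl fun j _ => by ring

theorem valency_edge [DecidableEq ι] (a a' i : ι) :
    valency (edge a a') i = (if i = a then 1 else 0) + if i = a' then 1 else 0 := by
  simp only [valency, edge_apply, ite_and, Finset.sum_add_distrib]
  congr 1
  · by_cases hi : i = a <;> simp [hi]
  · simp

end BracketProd

/-- Bracket monomials of regular graphs are algebraic over the values of the invariants. -/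
theorem bracketProd_mem {ι : Type} [Fintype ι] [DecidableEq ι] {n : ℕ}
    (hn : Fintype.card ι = n) (hpos : 0 < n) {K : Type} [Field K] [Algebra ℂ K]
    (L : IntermediateField ℂ K) (hint : ∀ x : K, IsIntegral L x → x ∈ L) (b c : ι → K)
    (hL : ∀ H ∈ invariantRing n, aeval (fun k : Fin (n + 1) => binCoeff b c k) H ∈ L)
    {e : ι → ι → ℕ} {d : ℕ} (he : ∀ i, valency e i = d) : bracketProd e b c ∈ L := by
  let F : Equiv.Perm ι → MvPolynomial (ι ⊕ ι) ℂ := fun σ =>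
    bracketProd e (fun i => X (Sum.inl (σ i))) (fun i => X (Sum.inr (σ i)))
  have hF : ∀ {A : Type} [CommRing A] [Algebra ℂ A] (b c : ι → A) (k : ℕ),
      aeval (Sum.elim b c) (binCoeff 1 F k) =
        binCoeff 1 (fun σ : Equiv.Perm ι => bracketProd e (b ∘ σ) (c ∘ σ)) k := by
    intro A _ _ b c k
    rw [map_binCoeff]
    congr 1
    · funext σ
      simp
    · funext σ
      rw [map_bracketProd]
      simp [Function.comp_def]
  have hmem : ∀ k, binCoeff 1 (fun σ : Equiv.Perm ι => bracketProd e (b ∘ σ) (c ∘ σ)) k ∈ L := by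
    intro k
    suffices h : ∃ H ∈ invariantRing n, ∀ {A : Type} [CommRing A] [Algebra ℂ A] (b c : ι → A),
        aeval (fun k : Fin (n + 1) => binCoeff b c k) H =
          aeval (Sum.elim b c) (binCoeff 1 F k) by
      obtain ⟨H, hH, hval⟩ := h
      rw [← hF, ← hval]
      exact hL H hH
    refine exists_invariant_of_symmetric hn hpos (d * k) (binCoeff 1 F k) ?_ ?_ ?_
    · intro σ b c
      refine (hF _ _ _).trans (Eq.trans ?_ (hF _ _ _).symm)
      exact binCoeff_comp_equiv (Equiv.mulLeft σ) 1
        (fun τ : Equiv.Perm ι => bracketProd e (b ∘ τ) (c ∘ τ)) k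
    · intro l b c
      refine (hF _ _ _).trans (Eq.trans ?_ (congrArg _ (hF _ _ _).symm))
      rw [pow_mul, ← binCoeff_mul_right]
      congr 1
      funext σ
      have h := bracketProd_mul he (l ∘ σ) (b ∘ σ) (c ∘ σ)
      rwa [show ∏ i, (l ∘ σ) i = ∏ i, l i from Equiv.prod_comp σ l] at h
    · intro g b c
      refine (hF _ _ _).trans (Eq.trans ?_ (hF _ _ _).symm)
      congr 1
      funext σ
      unfold bracketProd
      refine Finset.prod_congr rfl fun i _ => Finset.prod_congr rfl fun j _ => ?_
      congr 1
      have hdet : g.1 0 0 * g.1 1 1 - g.1 0 1 * g.1 1 0 = 1 := by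
        rw [← Matrix.det_fin_two]
        exact g.2
      simp only [bracket, Function.comp_apply]
      linear_combination (b (σ i) * c (σ j) - b (σ j) * c (σ i)) * hdet
  apply hint
  let Q : Polynomial K := ∏ σ : Equiv.Perm ι,
    (Polynomial.X - Polynomial.C (bracketProd e (b ∘ σ) (c ∘ σ)))
  have hC : ∀ k, binCoeff (fun _ => 1)
      (fun σ : Equiv.Perm ι => Polynomial.C (bracketProd e (b ∘ σ) (c ∘ σ))) k =
      Polynomial.C (binCoeff 1
        (fun σ : Equiv.Perm ι => bracketProd e (b ∘ σ) (c ∘ σ)) k) := by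
    intro k
    rw [map_binCoeff]
    simp only [Pi.one_apply, map_one]
  have hQm : Q.Monic := Polynomial.monic_prod_of_monic _ _ fun σ _ => Polynomial.monic_X_sub_C _
  have hQl : Q ∈ Polynomial.lifts (algebraMap L K) := by
    have h := prod_linear_eq_sum_binCoeff (fun _ : Equiv.Perm ι => Polynomial.C (1 : K))
      (fun σ => Polynomial.C (bracketProd e (b ∘ σ) (c ∘ σ))) Polynomial.X (-1)
    simp only [map_one, one_mul, mul_neg, mul_one, ← sub_eq_add_neg, hC] at h
    change Q ∈ _
    rw [show Q = _ from h]
    refine sum_mem fun k _ => ?_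
    have h1 : (-1 : Polynomial K) ^ k ∈ Polynomial.lifts (algebraMap L K) :=
      pow_mem (by simpa using Polynomial.C_mem_lifts (algebraMap L K) (-1)) _
    refine mul_mem (mul_mem ?_ (pow_mem (Polynomial.X_mem_lifts _) _)) h1
    exact Polynomial.C_mem_lifts (algebraMap L K) ⟨_, hmem k⟩
  obtain ⟨q, hq, -, hqm⟩ := Polynomial.lifts_and_natDegree_eq_and_monic hQl hQm
  refine ⟨q, hqm, ?_⟩
  rw [← Polynomial.eval_map, hq, Polynomial.eval_prod]
  exact Finset.prod_eq_zero (Finset.mem_univ 1) (by simp)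

theorem exists_swap_edges {ι : Type*} [Fintype ι] [DecidableEq ι] {e : ι → ι → ℕ} {a b a' b' : ι}
    (hne : a ≠ a') (h : e a b ≠ 0) (h' : e a' b' ≠ 0) :
    ∃ e' : ι → ι → ℕ, (∀ i, valency e' i = valency e i) ∧
      e' + (edge a b + edge a' b') = e + (edge a a' + edge b b') := by
  have hle : ∀ x y, (edge a b + edge a' b') x y ≤ e x y := by
    intro x y
    simp only [Pi.add_apply, edge_apply]
    by_cases h₁ : x = a ∧ y = b
    · obtain ⟨rfl, rfl⟩ := h₁
      simp [hne]
      omega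
    · by_cases h₂ : x = a' ∧ y = b'
      · obtain ⟨rfl, rfl⟩ := h₂
        rw [if_neg h₁]
        simp
        omega
      · simp [h₁, h₂]
  have heq : (fun x y => e x y + (edge a a' + edge b b') x y - (edge a b + edge a' b') x y) +
      (edge a b + edge a' b') = e + (edge a a' + edge b b') := by
    funext x y
    have := hle x y
    simp only [Pi.add_apply] at this ⊢
    omega
  refine ⟨_, fun i => ?_, heq⟩
  have hv := congrArg (fun f => valency f i) heq
  simp only [valency_add, valency_edge] at hv
  omega

/-- The regular graph on `P ⊕ Q` in which the vertices of `Q` are mutually non-adjacent and any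
other two distinct vertices are adjacent, provided that `Q` has fewer elements than `P`. -/
def baseGraph (P Q : Type*) [Fintype P] [Fintype Q] [DecidableEq P] : P ⊕ Q → P ⊕ Q → ℕ
  | Sum.inl a, Sum.inl a' => if a = a' then 0 else Fintype.card P - Fintype.card Q
  | Sum.inl _, Sum.inr _ => Fintype.card P - 1
  | Sum.inr _, Sum.inl _ => Fintype.card P - 1
  | Sum.inr _, Sum.inr _ => 0

theorem valency_baseGraph {P Q : Type*} [Fintype P] [Fintype Q] [DecidableEq P]
    (h : Fintype.card Q ≤ Fintype.card P) (x : P ⊕ Q) :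
    valency (baseGraph P Q) x = 2 * Fintype.card P * (Fintype.card P - 1) := by
  rcases x with a | a
  · have hp : ∀ a' : P, (if a = a' then 0 else Fintype.card P - Fintype.card Q) +
        (if a' = a then 0 else Fintype.card P - Fintype.card Q) =
        if a' = a then 0 else 2 * (Fintype.card P - Fintype.card Q) := by
      intro a'
      by_cases h : a' = a
      · simp [h]
      · simp [h, Ne.symm h]
        ring
    simp only [valency, Fintype.sum_sum_type, baseGraph, hp]
    rw [Finset.sum_ite, Finset.sum_const_zero, zero_add, Finset.sum_const, Finset.sum_const,
      Finset.filter_ne', Finset.card_erase_of_mem (Finset.mem_univ a), Finset.card_univ,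
      Finset.card_univ]
    obtain ⟨m, hm⟩ := Nat.exists_eq_add_of_le h
    rw [hm, Nat.add_sub_cancel_left]
    simp only [smul_eq_mul]
    ring
  · simp only [valency, Fintype.sum_sum_type, baseGraph]
    simp
    ring

section GenericForm

variable {K : Type} [Field K] {q t α r : ℕ}

/-- First coefficients of the linear factors of a scalar multiple of
`x ^ α * y ^ r * ∏ j, (x ^ t ± w j ^ t * y ^ t)`. -/
def genericLeft (γ : K) : (Fin q × Fin t) ⊕ (Fin α ⊕ Fin r) → K
  | Sum.inl _ => γ
  | Sum.inr (Sum.inl _) => γ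
  | Sum.inr (Sum.inr _) => 0

/-- Second coefficients of the linear factors of a scalar multiple of
`x ^ α * y ^ r * ∏ j, (x ^ t ± w j ^ t * y ^ t)`. -/
def genericRight (γ ζ : K) (w : Fin q → K) : (Fin q × Fin t) ⊕ (Fin α ⊕ Fin r) → K
  | Sum.inl (j, k) => γ * (ζ ^ (k : ℕ) * w j)
  | Sum.inr (Sum.inl _) => 0
  | Sum.inr (Sum.inr _) => γ

theorem pow_mul_binCoeff_generic [NeZero t] {ζ : K} (hζ : ζ ^ t = 1) (γ : K) (w : Fin q → K)
    (k : ℕ) :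
    ζ ^ k * binCoeff (genericLeft γ : (Fin q × Fin t) ⊕ (Fin α ⊕ Fin r) → K)
      (genericRight γ ζ w) k =
    ζ ^ r * binCoeff (genericLeft γ : (Fin q × Fin t) ⊕ (Fin α ⊕ Fin r) → K)
      (genericRight γ ζ w) k := by
  let e : (Fin q × Fin t) ⊕ (Fin α ⊕ Fin r) ≃ (Fin q × Fin t) ⊕ (Fin α ⊕ Fin r) :=
    Equiv.sumCongr (Equiv.prodCongr (Equiv.refl _) (Equiv.addRight 1)) (Equiv.refl _)
  let l : (Fin q × Fin t) ⊕ (Fin α ⊕ Fin r) → K :=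
    Sum.elim (fun _ => 1) (Sum.elim (fun _ => 1) fun _ => ζ)
  have hl : ∏ i, l i = ζ ^ r := by simp [l, Fintype.prod_sum_type]
  have h₁ : l * (genericLeft γ ∘ e) = genericLeft γ := by
    funext i
    rcases i with i | i | i <;> simp [l, e, genericLeft]
  have h₂ : l * (genericRight γ ζ w ∘ e) = fun i => ζ * genericRight γ ζ w i := by
    funext i
    rcases i with ⟨j, i⟩ | i | i
    · have h : ζ ^ ((i + 1 : Fin t) : ℕ) = ζ ^ ((i : ℕ) + 1) := by
        rw [Fin.val_add, ← pow_eq_pow_mod _ hζ, pow_add, pow_add, Fin.val_one',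
          ← pow_eq_pow_mod _ hζ]
      simp only [l, e, Pi.mul_apply, Function.comp_apply, Equiv.sumCongr_apply, Sum.map_inl,
        Equiv.prodCongr_apply, Prod.map_apply, Equiv.refl_apply, Equiv.coe_addRight, Sum.elim_inl,
        genericRight, h]
      ring
    · simp [l, e, genericRight]
    · simp [l, e, genericRight]
  rw [← binCoeff_mul_right, ← h₂, ← hl]
  nth_rw 1 [← h₁]
  rw [binCoeff_mul, binCoeff_comp_equiv]

/-- The parameters of the generic form lie in any relatively algebraically closed field that
contains the values of all invariants. -/
theorem generic_mem [Algebra ℂ K] [NeZero q] {n : ℕ} (hn : q * t + (α + r) = n) (ht : 1 < t)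
    (hlt : α + r < q * t)
    (L : IntermediateField ℂ K) (hint : ∀ x : K, IsIntegral L x → x ∈ L)
    {γ ζ : K} {w : Fin q → K} (hγ : γ ≠ 0) (hζ : IsPrimitiveRoot ζ t) (hζL : ζ ∈ L)
    (hw0 : w 0 = 1) (hw : ∀ j, w j ≠ 0)
    (hinj : ∀ (i j : Fin q) (k l : Fin t),
      ζ ^ (k : ℕ) * w i = ζ ^ (l : ℕ) * w j → i = j ∧ k = l)
    (hL : ∀ H ∈ invariantRing n,
      aeval (fun k : Fin (n + 1) =>
        binCoeff (genericLeft γ : (Fin q × Fin t) ⊕ (Fin α ⊕ Fin r) → K)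
          (genericRight γ ζ w) k) H ∈ L) :
    γ ∈ L ∧ ∀ j, w j ∈ L := by
  have hcard : Fintype.card ((Fin q × Fin t) ⊕ (Fin α ⊕ Fin r)) = n := by simp [hn]
  have hcP : Fintype.card (Fin q × Fin t) = q * t := by simp
  have hcQ : Fintype.card (Fin α ⊕ Fin r) = α + r := by simp
  have hq : 0 < q := Nat.pos_of_ne_zero (NeZero.ne q)
  have hqt : 2 ≤ q * t := by nlinarith
  have hpos : 0 < n := by omega
  have hζ0 : ζ ≠ 0 := hζ.ne_zero (by omega)
  have hζ1 : ζ - 1 ≠ 0 := sub_ne_zero.2 (hζ.ne_one ht)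
  set b : (Fin q × Fin t) ⊕ (Fin α ⊕ Fin r) → K := genericLeft γ with hb
  set c : (Fin q × Fin t) ⊕ (Fin α ⊕ Fin r) → K := genericRight γ ζ w with hc
  set e := baseGraph (Fin q × Fin t) (Fin α ⊕ Fin r) with he
  have hval : ∀ i, valency e i = 2 * (q * t) * (q * t - 1) := by
    intro i
    rw [he, valency_baseGraph (by omega), hcP]
  have hdist : ∀ γ' : K, γ' ≠ 0 → ∀ x y, e x y ≠ 0 →
      bracket (genericLeft γ') (genericRight γ' ζ w) x y ≠ 0 := by
    intro γ' hγ' x y hxy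
    rcases x with ⟨i, k⟩ | x
    · rcases y with ⟨j, l⟩ | y | y
      · simp only [he, baseGraph] at hxy
        have hne : (i, k) ≠ (j, l) := fun h => by simp [h] at hxy
        simp only [bracket, genericLeft, genericRight]
        intro h
        have h' : ζ ^ (l : ℕ) * w j = ζ ^ (k : ℕ) * w i := by
          have := mul_ne_zero hγ' hγ'
          apply mul_left_cancel₀ this
          linear_combination h
        obtain ⟨rfl, rfl⟩ := hinj _ _ _ _ h'
        exact hne rfl
      · simp [bracket, genericLeft, genericRight, hγ', hζ0, hw]
      · simp [bracket, genericLeft, genericRight, hγ']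
    · rcases y with ⟨j, l⟩ | y
      · rcases x with x | x
        · simp [bracket, genericLeft, genericRight, hγ', hζ0, hw]
        · simp [bracket, genericLeft, genericRight, hγ']
      · simp [he, baseGraph] at hxy
  have hF : bracketProd e b c ∈ L := bracketProd_mem hcard hpos L hint b c hL hval
  have hF0 : bracketProd e b c ≠ 0 := bracketProd_ne_zero (hdist γ hγ)
  have hwL : ∀ j, w j ∈ L := by
    intro j
    by_cases hj : j = 0
    · rw [hj, hw0]
      exact one_mem L
    have hedge : ∀ i : Fin q, e (Sum.inl (i, ⟨0, by omega⟩)) (Sum.inl (i, ⟨1, ht⟩)) ≠ 0 := by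
      intro i
      simp only [he, baseGraph, hcP, hcQ]
      rw [if_neg (by simp)]
      omega
    obtain ⟨e', hv', heq⟩ := exists_swap_edges
      (by simpa using Ne.symm hj : (Sum.inl (0, ⟨0, _⟩) : (Fin q × Fin t) ⊕ (Fin α ⊕ Fin r)) ≠
        Sum.inl (j, ⟨0, _⟩)) (hedge 0) (hedge j)
    have hF' : bracketProd e' b c ∈ L :=
      bracketProd_mem hcard hpos L hint b c hL fun i => (hv' i).trans (hval i)
    have hrel := congrArg (fun f => bracketProd f b c) heq
    simp only [bracketProd_add, bracketProd_edge] at hrel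
    simp only [bracket, hb, hc, genericLeft, genericRight, hw0] at hrel
    simp only [← hb, ← hc, pow_zero, pow_one, one_mul, mul_one] at hrel
    have hrel' : bracketProd e' b c * (ζ - 1) ^ 2 * w j =
        bracketProd e b c * ζ * (w j - 1) ^ 2 := by
      apply mul_left_cancel₀ (pow_ne_zero 4 hγ)
      linear_combination hrel
    set y := bracketProd e' b c * (ζ - 1) ^ 2 / (bracketProd e b c * ζ) + 2 with hy
    have hyL : y ∈ L := by
      refine add_mem (div_mem (mul_mem hF' (pow_mem (sub_mem hζL (one_mem L)) 2))
        (mul_mem hF hζL)) ?_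
      exact ofNat_mem L 2
    have hquad : w j ^ 2 - y * w j + 1 = 0 := by
      rw [hy]
      field_simp
      linear_combination -hrel'
    refine hint _ ⟨Polynomial.X ^ 2 - Polynomial.C ⟨y, hyL⟩ * Polynomial.X + 1, ?_, ?_⟩
    · monicity!
    · simpa using hquad
  refine ⟨?_, hwL⟩
  have hG : bracketProd e (genericLeft 1) (genericRight 1 ζ w) ∈ L := by
    refine prod_mem fun x _ => prod_mem fun y _ => pow_mem ?_ _
    have h1 : ∀ x : (Fin q × Fin t) ⊕ (Fin α ⊕ Fin r), genericLeft (1 : K) x ∈ L := by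
      intro x
      rcases x with x | x | x
      · exact one_mem L
      · exact one_mem L
      · exact zero_mem L
    have h2 : ∀ x : (Fin q × Fin t) ⊕ (Fin α ⊕ Fin r), genericRight 1 ζ w x ∈ L := by
      intro x
      rcases x with ⟨j, k⟩ | x | x
      · exact mul_mem (one_mem L) (mul_mem (pow_mem hζL _) (hwL j))
      · exact zero_mem L
      · exact one_mem L
    exact sub_mem (mul_mem (h1 x) (h2 y)) (mul_mem (h1 y) (h2 x))
  have hG0 : bracketProd e (genericLeft 1) (genericRight 1 ζ w) ≠ 0 :=
    bracketProd_ne_zero (hdist 1 one_ne_zero)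
  have hscale := bracketProd_mul hval (fun _ => γ) (genericLeft 1) (genericRight 1 ζ w)
  have hbl : (fun _ => γ) * genericLeft 1 = b := by
    funext x
    rcases x with x | x | x <;> simp [hb, genericLeft]
  have hcr : (fun _ => γ) * genericRight 1 ζ w = c := by
    funext x
    rcases x with x | x | x <;> simp [hc, genericRight]
  rw [hbl, hcr, Finset.prod_const, ← pow_mul] at hscale
  have hpow := div_mem hF hG
  rw [hscale, mul_div_cancel_right₀ _ hG0] at hpow
  refine hint _ (IsIntegral.of_pow ?_ (isIntegral_algebraMap (x := (⟨_, hpow⟩ : L))))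
  rw [Finset.card_univ, hcard]
  have : 0 < q * t - 1 := by omega
  positivity

end GenericForm

theorem aeval_mul_of_isHomogeneous {σ K : Type*} [CommRing K] [Algebra ℂ K] {d : ℕ}
    {H : MvPolynomial σ ℂ} (hH : H.IsHomogeneous d) (z : K) (a : σ → K) :
    aeval (fun k => z * a k) H = z ^ d * aeval a H := by
  rw [aeval_def, aeval_def, eval₂_eq, eval₂_eq, Finset.mul_sum]
  refine Finset.sum_congr rfl fun m hm => ?_
  have hdeg : ∑ i ∈ m.support, m i = d := hH.degree_eq_sum_deg_support hm |>.symm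
  simp only [mul_pow, Finset.prod_mul_distrib, Finset.prod_pow_eq_pow_sum, hdeg]
  ring

theorem sl2Act_diagonal {n : ℕ} (hpos : 0 < n) {g : Matrix.SpecialLinearGroup (Fin 2) ℂ} {η : ℂ}
    (hη : η ≠ 0) (hg : g.1 = !![η, 0; 0, η⁻¹]) (a : Fin (n + 1) → ℂ) :
    sl2Act n g a = fun k : Fin (n + 1) => η ^ n * (η⁻¹ ^ 2) ^ (k : ℕ) * a k := by
  obtain ⟨b, c, rfl⟩ := exists_binCoeff_eq (Fintype.card_fin n) hpos a
  refine (sl2Act_binCoeff (Fintype.card_fin n) g b c).trans ?_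
  funext k
  rw [hg]
  have hb : (fun i => b i * η + c i * 0) = (fun _ => η) * b := by
    funext i
    simp [mul_comm]
  have hc : (fun i => b i * 0 + c i * η⁻¹) = (fun _ => η) * fun i => η⁻¹ ^ 2 * c i := by
    funext i
    simp
    field_simp
  simp only [Matrix.of_apply, Matrix.cons_val', Matrix.cons_val_zero, Matrix.cons_val_one,
    Matrix.cons_val_fin_one]
  rw [hb, hc, binCoeff_mul, binCoeff_mul_right]
  simp
  ring

theorem aeval_diagonal {K : Type*} [CommRing K] [Algebra ℂ K] {n : ℕ} (hpos : 0 < n) {η : ℂ}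
    (hη : η ≠ 0) {H : MvPolynomial (Fin (n + 1)) ℂ} (hH : H ∈ invariantRing n)
    (a : Fin (n + 1) → K) :
    aeval (fun k : Fin (n + 1) => algebraMap ℂ K (η ^ n * (η⁻¹ ^ 2) ^ (k : ℕ)) * a k) H =
      aeval a H := by
  let g : Matrix.SpecialLinearGroup (Fin 2) ℂ :=
    ⟨!![η, 0; 0, η⁻¹], by simp [Matrix.det_fin_two, hη]⟩
  have key : bind₁ (fun k : Fin (n + 1) => C (η ^ n * (η⁻¹ ^ 2) ^ (k : ℕ)) * X k) H = H := by
    refine MvPolynomial.funext fun x => ?_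
    refine Eq.trans ?_ (hH g x)
    rw [sl2Act_diagonal hpos hη rfl]
    rw [← coe_aeval_eq_eval, ← coe_aeval_eq_eval, RingHom.coe_coe, RingHom.coe_coe, aeval_bind₁]
    simp
  conv_rhs => rw [← key, aeval_bind₁]
  simp

theorem dvd_mul_of_aeval_ne_zero {K : Type*} [CommRing K] [IsDomain K] [Algebra ℂ K]
    {n m r d : ℕ} (hpos : 0 < n) (hr : 2 * r ≤ n) {η : ℂ} (hη0 : η ≠ 0)
    (hη : IsPrimitiveRoot η m)
    {a : Fin (n + 1) → K}
    (ha : ∀ k : Fin (n + 1),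
      algebraMap ℂ K (η ^ 2) ^ (k : ℕ) * a k = algebraMap ℂ K (η ^ 2) ^ r * a k)
    {H : MvPolynomial (Fin (n + 1)) ℂ} (hH : H ∈ invariantRing n) (hd : H.IsHomogeneous d)
    (hne : aeval a H ≠ 0) : m ∣ (n - 2 * r) * d := by
  have hscale : (fun k : Fin (n + 1) =>
      algebraMap ℂ K (η ^ n * (η⁻¹ ^ 2) ^ (k : ℕ)) * a k) =
      fun k => algebraMap ℂ K (η ^ (n - 2 * r)) * a k := by
    funext k
    by_cases h0 : a k = 0
    · simp [h0]
    · have h := mul_right_cancel₀ h0 (ha k)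
      rw [← map_pow, ← map_pow] at h
      have h' := FaithfulSMul.algebraMap_injective ℂ K h
      congr 2
      rw [inv_pow, inv_pow, h', ← pow_mul, pow_sub₀ _ hη0 hr]
  have h := aeval_diagonal hpos hη0 hH a
  rw [hscale, aeval_mul_of_isHomogeneous hd] at h
  have h1 : algebraMap ℂ K ((η ^ (n - 2 * r)) ^ d) = algebraMap ℂ K 1 := by
    rw [map_pow, map_one]
    exact mul_right_cancel₀ hne (h.trans (one_mul _).symm)
  rw [← hη.pow_eq_one_iff_dvd, pow_mul]
  exact FaithfulSMul.algebraMap_injective ℂ K h1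

theorem exists_exponents {n t : ℕ} (hodd : Odd n) (ht : 1 < t) (htn : t ≤ n - 1) :
    ∃ q r α : ℕ, q * t + (α + r) = n ∧ (n - 1) / t ≤ q ∧ r ≤ α ∧ α + r < q * t ∧
      (n - 2 * r).Coprime (2 * t) := by
  obtain ⟨Q, s, hs, hn⟩ : ∃ Q s, s < t ∧ n = Q * t + s :=
    ⟨n / t, n % t, Nat.mod_lt _ (by omega), (Nat.div_add_mod' n t).symm⟩
  have hQ : 0 < Q := by
    rcases Nat.eq_zero_or_pos Q with rfl | h
    · omega
    · exact h
  have hle : t ≤ Q * t := Nat.le_mul_of_pos_left t hQ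
  have hcop : ∀ {m c k : ℕ}, m = k * t + c → Odd m → c.Coprime t → m.Coprime (2 * t) := by
    intro m c k hm hm' hc
    refine Nat.Coprime.mul_right hm'.coprime_two_right ?_
    rw [hm]
    simpa using hc
  have hodd' : ∀ {r}, 2 * r ≤ n → Odd (n - 2 * r) := fun h =>
    Nat.Odd.sub_even h hodd (even_two_mul _)
  rcases Nat.eq_zero_or_pos s with rfl | hs0
  · have hQt : Odd (Q * t) := by simpa [hn] using hodd
    obtain ⟨⟨u, rfl⟩, v, rfl⟩ := Nat.odd_mul.1 hQt
    have hu : 0 < u := by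
      rcases Nat.eq_zero_or_pos u with rfl | h
      · omega
      · exact h
    have hmul : (2 * u + 1) * (2 * v + 1) = 2 * u * (2 * v + 1) + (2 * v + 1) := by ring
    have hmul' : 2 * v + 1 ≤ u * (2 * v + 1) := Nat.le_mul_of_pos_left _ hu
    have hmul'' : 2 * u * (2 * v + 1) = 2 * (u * (2 * v + 1)) := by ring
    refine ⟨2 * u, v, v + 1, by omega, ?_, by omega, by omega, ?_⟩
    · rw [Nat.le_iff_lt_add_one, Nat.div_lt_iff_lt_mul (by omega)]
      omega
    · exact hcop (k := 2 * u) (c := 1) (by omega) (hodd' (by omega)) (Nat.coprime_one_left _)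
  · have hdiv : (n - 1) / t ≤ Q := by
      rw [Nat.le_iff_lt_add_one, Nat.div_lt_iff_lt_mul (by omega), add_mul]
      omega
    rcases Nat.even_or_odd s with ⟨v, rfl⟩ | ⟨v, rfl⟩
    · have hQt : Odd (Q * t) := by
        rw [hn, Nat.odd_add] at hodd
        exact hodd.2 ⟨v, rfl⟩
      refine ⟨Q, v - 1, v + 1, by omega, hdiv, by omega, by omega, ?_⟩
      exact hcop (k := Q) (c := 2) (by omega) (hodd' (by omega))
        (Nat.odd_mul.1 hQt).2.coprime_two_left
    · refine ⟨Q, v, v + 1, by omega, hdiv, by omega, by omega, ?_⟩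
      exact hcop (k := Q) (c := 1) (by omega) (hodd' (by omega)) (Nat.coprime_one_left _)

theorem even_of_invariant {n d : ℕ} (hodd : Odd n) {H : MvPolynomial (Fin (n + 1)) ℂ}
    (hH : H ∈ invariantRing n) (hd : H.IsHomogeneous d) (hne : H ≠ 0) : 2 ∣ d := by
  have h := dvd_mul_of_aeval_ne_zero (r := 0) hodd.pos (by omega) (by norm_num)
    (IsPrimitiveRoot.neg_one 0 (by norm_num)) (a := (X : Fin (n + 1) → MvPolynomial _ ℂ))
    (by simp) hH hd (by simpa using hne)
  exact hodd.coprime_two_left.dvd_of_dvd_mul_left (by simpa using h)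

open scoped IntermediateField.algebraAdjoinAdjoin in
theorem trdeg_le_of_isAlgebraic_adjoin {F K : Type*} [Field F] [Field K] [Algebra F K]
    (T : Set K) (h : ∀ x : K, IsAlgebraic (IntermediateField.adjoin F T) x) :
    Algebra.trdeg F K ≤ Cardinal.mk T := by
  have : Algebra.IsAlgebraic (Algebra.adjoin F T) K := by
    refine ⟨fun x => ?_⟩
    exact (IsFractionRing.isAlgebraic_iff (Algebra.adjoin F T) (IntermediateField.adjoin F T) K).2
      (h x)
  exact Algebra.IsAlgebraic.trdeg_le_cardinalMk F T

theorem isIntegral_map_of_forall_mem {B A K : Type*} [CommRing A] [Algebra ℂ A]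
    [Field K] [Algebra ℂ K] (p : B → A) (hfin : Module.Finite (Algebra.adjoin ℂ (Set.range p)) A)
    (φ : A →ₐ[ℂ] K) (L : IntermediateField ℂ K) (hL : ∀ k, φ (p k) ∈ L) (x : A) :
    IsIntegral L (φ x) := by
  have hmem : ∀ y ∈ Algebra.adjoin ℂ (Set.range p), φ y ∈ L := by
    intro y hy
    have : Algebra.adjoin ℂ (Set.range p) ≤ L.toSubalgebra.comap φ := by
      refine Algebra.adjoin_le ?_
      rintro _ ⟨k, rfl⟩
      exact hL k
    exact this hy
  let ψ : Algebra.adjoin ℂ (Set.range p) →+* L :=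
    ((φ.comp (Algebra.adjoin ℂ (Set.range p)).val).codRestrict L.toSubalgebra
      fun y => hmem y y.2 : Algebra.adjoin ℂ (Set.range p) →ₐ[ℂ] L.toSubalgebra).toRingHom
  have hx : IsIntegral (Algebra.adjoin ℂ (Set.range p)) x := IsIntegral.of_finite _ x
  exact hx.map_of_comp_eq ψ φ.toRingHom rfl

theorem eq_of_pow_mul_eq {q t : ℕ} [NeZero q] {ζ : ℂ} (hζ : IsPrimitiveRoot ζ t) (ht : 0 < t)
    {i j : Fin q} {k l : Fin t}
    (h : C (ζ ^ (k : ℕ)) * (if i = 0 then 1 else X i) =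
      (C (ζ ^ (l : ℕ)) * (if j = 0 then 1 else X j) : MvPolynomial (Fin q) ℂ)) :
    i = j ∧ k = l := by
  have heval : ∀ (k : Fin t) (i : Fin q), eval (fun j : Fin q => ((j : ℕ) + 1 : ℂ))
      (C (ζ ^ (k : ℕ)) * (if i = 0 then 1 else X i)) = ζ ^ (k : ℕ) * ((i : ℕ) + 1) := by
    intro k i
    by_cases hi : i = 0
    · simp [hi]
    · simp [hi]
  have h' := congrArg (eval fun j : Fin q => ((j : ℕ) + 1 : ℂ)) h
  rw [heval, heval] at h'
  have hnorm : ‖ζ‖ = 1 := hζ.norm'_eq_one ht.ne'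
  have hn := congrArg norm h'
  have hi : ∀ i : ℕ, ‖(i : ℂ) + 1‖ = i + 1 := fun i => by
    exact_mod_cast Complex.norm_natCast (i + 1)
  rw [norm_mul, norm_mul, norm_pow, norm_pow, hnorm, one_pow, one_pow, one_mul, one_mul, hi, hi]
    at hn
  have hij : i = j := by
    apply Fin.ext
    exact_mod_cast add_right_cancel hn
  subst hij
  refine ⟨rfl, Fin.ext (hζ.pow_inj k.2 l.2 (mul_right_cancel₀ ?_ h'))⟩
  exact_mod_cast Nat.succ_ne_zero (i : ℕ)

theorem le_card_filter_dvd {n q t r α : ℕ} (hn : q * t + (α + r) = n) (ht : 1 < t) (hr : r ≤ α)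
    (hlt : α + r < q * t) (hcop : (n - 2 * r).Coprime (2 * t)) {d : Fin (n - 2) → ℕ}
    {p : Fin (n - 2) → invariantRing n} (hp : IsHSOP n d p) :
    q ≤ (Finset.univ.filter fun k => 2 * t ∣ d k).card := by
  obtain ⟨-, hhom, -, hfin⟩ := hp
  have hq : q ≠ 0 := by
    rintro rfl
    omega
  have : NeZero q := ⟨hq⟩
  have : NeZero t := ⟨by omega⟩
  let K := FractionRing (MvPolynomial (Fin q) ℂ)
  have hinjK : Function.Injective (algebraMap (MvPolynomial (Fin q) ℂ) K) :=
    IsFractionRing.injective _ _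
  let x : Fin q → K := fun j => algebraMap (MvPolynomial (Fin q) ℂ) K (X j)
  have hx : ∀ j, x j ≠ 0 := fun j => by
    simp [x]
  let w : Fin q → K := fun j => algebraMap (MvPolynomial (Fin q) ℂ) K (if j = 0 then 1 else X j)
  let η : ℂ := Complex.exp (2 * Real.pi * Complex.I / ((2 * t : ℕ) : ℂ))
  have hη : IsPrimitiveRoot η (2 * t) := Complex.isPrimitiveRoot_exp _ (by omega)
  have hη0 : η ≠ 0 := hη.ne_zero (by omega)
  have hζ : IsPrimitiveRoot (η ^ 2) t := hη.pow (by omega) rfl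
  let ζ : K := algebraMap ℂ K (η ^ 2)
  have hζK : IsPrimitiveRoot ζ t := hζ.map_of_injective (FaithfulSMul.algebraMap_injective ℂ K)
  let b : (Fin q × Fin t) ⊕ (Fin α ⊕ Fin r) → K := genericLeft (x 0)
  let c : (Fin q × Fin t) ⊕ (Fin α ⊕ Fin r) → K := genericRight (x 0) ζ w
  let φ : MvPolynomial (Fin (n + 1)) ℂ →ₐ[ℂ] K := aeval fun k => binCoeff b c k
  let S : Finset (Fin (n - 2)) := Finset.univ.filter fun k => 2 * t ∣ d k
  let T : Set K := (fun k => φ (p k)) '' S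
  let L : IntermediateField ℂ K :=
    (algebraicClosure (IntermediateField.adjoin ℂ T) K).restrictScalars ℂ
  have hpT : ∀ k, φ (p k) ∈ IntermediateField.adjoin ℂ T := by
    intro k
    by_cases h0 : φ (p k) = 0
    · rw [h0]
      exact zero_mem _
    · refine IntermediateField.subset_adjoin ℂ T ⟨k, ?_, rfl⟩
      have := dvd_mul_of_aeval_ne_zero (by omega) (by omega : 2 * r ≤ n) hη0 hη
        (fun k => pow_mul_binCoeff_generic hζK.pow_eq_one (x 0) w k) (p k).2 (hhom k) h0
      simpa [S] using hcop.symm.dvd_of_dvd_mul_left this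
  have hL : ∀ H ∈ invariantRing n, φ H ∈ L := by
    intro H hH
    have := isIntegral_map_of_forall_mem p hfin (φ.comp (invariantRing n).val) _ hpT ⟨H, hH⟩
    exact mem_algebraicClosure_iff'.2 this
  have hint : ∀ y : K, IsIntegral L y → y ∈ L := by
    intro y hy
    exact mem_algebraicClosure_iff'.2
      (isIntegral_trans (A := algebraicClosure (IntermediateField.adjoin ℂ T) K) y hy)
  obtain ⟨h0, hw⟩ := generic_mem hn ht hlt L hint (hx 0) hζK (L.algebraMap_mem _) (by simp [w])
    (fun j => by
      simp only [w]
      split_ifs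
      · simp
      · exact hx j)
    (fun i j k l h => eq_of_pow_mul_eq hζ (by omega) (hinjK (by
      simpa only [map_mul, w, ζ, map_pow,
        IsScalarTower.algebraMap_apply ℂ (MvPolynomial (Fin q) ℂ) K, algebraMap_eq] using h)))
    hL
  have hxL : ∀ j, x j ∈ L := by
    intro j
    by_cases hj : j = 0
    · exact hj ▸ h0
    · simpa [w, hj] using hw j
  have hLtop : ∀ y : K, y ∈ L := by
    have hpoly : ∀ f : MvPolynomial (Fin q) ℂ, algebraMap _ K f ∈ L := by
      intro f
      induction f using MvPolynomial.induction_on with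
      | C a => exact L.algebraMap_mem a
      | add f g hf hg =>
        rw [map_add]
        exact add_mem hf hg
      | mul_X f j hf =>
        rw [map_mul]
        exact mul_mem hf (hxL j)
    intro y
    obtain ⟨f, g, -, rfl⟩ := IsFractionRing.div_surjective (A := MvPolynomial (Fin q) ℂ) y
    exact div_mem (hpoly f) (hpoly g)
  have htr : Algebra.trdeg ℂ K ≤ Cardinal.mk T :=
    trdeg_le_of_isAlgebraic_adjoin T fun y =>
      (mem_algebraicClosure_iff'.1 (hLtop y)).isAlgebraic
  have hqtr : (q : Cardinal) ≤ Algebra.trdeg ℂ K := by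
    have hX : AlgebraicIndependent ℂ x :=
      (algebraicIndependent_X (Fin q) ℂ).map' (f := IsScalarTower.toAlgHom ℂ _ K) hinjK
    simpa using hX.cardinalMk_le_trdeg
  have hT : Cardinal.mk T ≤ S.card := by
    simpa using Cardinal.mk_image_le (f := fun k => φ (p k)) (s := (S : Set (Fin (n - 2))))
  exact_mod_cast hqtr.trans (htr.trans hT)

theorem stmt_4 (n : ℕ) (hn : 3 ≤ n) (hodd : Odd n) (t : ℕ) (ht : 1 < t)
    (d : Fin (n-2) → ℕ) (p : Fin (n-2) → invariantRing n) (hp : IsHSOP n d p) :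
    (n - 1) / t ≤ (Finset.univ.filter fun k => 2 * t ∣ d k).card ∧
    ∀ k, 2 ∣ d k := by
  refine ⟨?_, fun k => ?_⟩
  · rcases Nat.lt_or_ge (n - 1) t with h | h
    · rw [Nat.div_eq_of_lt h]
      exact Nat.zero_le _
    · obtain ⟨q, r, α, hqn, hle, hr, hlt, hcop⟩ := exists_exponents hodd ht h
      exact hle.trans (le_card_filter_dvd hqn ht hr hlt hcop hp)
  · obtain ⟨-, hhom, hind, -⟩ := hp
    exact even_of_invariant hodd (p k).2 (hhom k)
      (Subtype.coe_injective.ne (hind.ne_zero k))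
end
end

section
/- Let n ≥ 3 and let d_1,…,d_{n−2} be positive integers satisfying the following conditions for every integer t > 1: if n is odd, then all d_i are even and at least ⌊(n−1)/t⌋ of the d_i are divisible by 2t; if n is even, then at least ⌊(n−1)/t⌋ of the d_i are divisible by t, and if moreover n ≡ 2 (mod 4) then at least n/2 of the d_i are even. Then the formal power series P(t)·∏_{i=1}^{n−2}(t^{d_i} − 1) is a polynomial in t. -/
set_option synthInstance.maxHeartbeats 1000000
noncomputable section

open MvPolynomial

/-- The space of invariants of degree `m` of the binary form of degree `n`. -/
def invariantSpace (n m : ℕ) : Submodule ℂ (MvPolynomial (Fin (n+1)) ℂ) :=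
  Subalgebra.toSubmodule (invariantRing n) ⊓ MvPolynomial.homogeneousSubmodule (Fin (n+1)) ℂ m

/-- `hdim n m = h^n_m`, the dimension over `ℂ` of the space of invariants of degree `m`
of the binary form of degree `n`. -/
def hdim (n m : ℕ) : ℕ := Module.finrank ℂ (invariantSpace n m)

/-! ### A graded form of the representation theory of `sl₂` -/

section GradedSl2

variable {V : Type*} [AddCommGroup V] [Module ℂ V] {W : ℤ → Submodule ℂ V} {E F : V →ₗ[ℂ] V}

theorem sl2_pow_raise_lower (hE : ∀ k, ∀ v ∈ W k, E v ∈ W (k + 2))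
    (hEF : ∀ k, ∀ v ∈ W k, E (F v) = F (E v) + (k : ℂ) • v) (N : ℕ) :
    ∀ k, ∀ v ∈ W k, (E ^ (N + 1)) (F v) =
      F ((E ^ (N + 1)) v) + ((N + 1 : ℂ) * (k + N)) • (E ^ N) v := by
  induction N with
  | zero => intro k v hv; simp [hEF k v hv]
  | succ N ih =>
    intro k v hv
    have h1 : (E ^ (N + 1)) (E v) = (E ^ (N + 1 + 1)) v := by
      rw [pow_succ E (N + 1), Module.End.mul_apply]
    have h2 : (E ^ N) (E v) = (E ^ (N + 1)) v := by rw [pow_succ E N, Module.End.mul_apply]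
    rw [pow_succ, Module.End.mul_apply, hEF k v hv, map_add, ih (k + 2) _ (hE k v hv), map_smul,
      h1, h2, add_assoc, ← add_smul]
    congr 2
    push_cast
    ring

theorem sl2_raise_surjective (hE : ∀ k, ∀ v ∈ W k, E v ∈ W (k + 2))
    (hF : ∀ k, ∀ v ∈ W k, F v ∈ W (k - 2))
    (hEF : ∀ k, ∀ v ∈ W k, E (F v) = F (E v) + (k : ℂ) • v) {k : ℤ} (hk : 0 < k) (N : ℕ) :
    ∀ v ∈ W k, (E ^ N) v = 0 → ∃ u ∈ W (k - 2), E u = v := by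
  induction N with
  | zero => intro v _ h; exact ⟨0, zero_mem _, by simpa using h.symm⟩
  | succ N ih =>
    intro v hv h
    set c : ℂ := (N + 1 : ℂ) * (k + N) with hc
    have hc0 : c ≠ 0 := by
      have h1 : ((N + 1 : ℤ) * (k + N) : ℤ) ≠ 0 := by positivity
      have h2 : (((N + 1 : ℤ) * (k + N) : ℤ) : ℂ) ≠ 0 := by exact_mod_cast h1
      simpa [hc] using h2
    have hEFv : E (F v) ∈ W k := by simpa using hE _ _ (hF k v hv)
    have key := sl2_pow_raise_lower hE hEF N k v hv
    rw [h, map_zero, zero_add, pow_succ, Module.End.mul_apply] at key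
    obtain ⟨u, hu, hu'⟩ := ih (E (F v) - c • v) (sub_mem hEFv (Submodule.smul_mem _ _ hv))
      (by rw [map_sub, key, map_smul, sub_self])
    refine ⟨c⁻¹ • (F v - u), Submodule.smul_mem _ _ (sub_mem (hF k v hv) hu), ?_⟩
    rw [map_smul, map_sub, hu', sub_sub_cancel, smul_smul, inv_mul_cancel₀ hc0, one_smul]

theorem sl2_raise_injective (hF : ∀ k, ∀ v ∈ W k, F v ∈ W (k - 2))
    (hEF : ∀ k, ∀ v ∈ W k, E (F v) = F (E v) + (k : ℂ) • v) {k : ℤ} (hk : k < 0)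
    {v : V} (hv : v ∈ W k) (hEv : E v = 0) (N : ℕ) (hN : (F ^ N) v = 0) : v = 0 := by
  have hmem (j : ℕ) : (F ^ j) v ∈ W (k - 2 * j) := by
    induction j with
    | zero => simpa using hv
    | succ j ih =>
      rw [pow_succ', Module.End.mul_apply]
      convert hF _ _ ih using 2
      push_cast
      ring
  have hcomm (j : ℕ) : E ((F ^ (j + 1)) v) = ((j + 1 : ℂ) * (k - j)) • (F ^ j) v := by
    induction j with
    | zero => simp [hEF k v hv, hEv]
    | succ j ih =>
      rw [pow_succ', Module.End.mul_apply, hEF _ _ (hmem (j + 1)), ih, map_smul,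
        ← Module.End.mul_apply, ← pow_succ', ← add_smul]
      congr 1
      push_cast
      ring
  induction N with
  | zero => simpa using hN
  | succ N ih =>
    refine ih ?_
    have h := hcomm N
    rw [hN, map_zero] at h
    refine (smul_eq_zero.mp h.symm).resolve_left ?_
    have h1 : ((N + 1 : ℤ) * (k - N) : ℤ) ≠ 0 :=
      mul_ne_zero (by positivity) (by have := Int.natCast_nonneg N; omega)
    have h2 : (((N + 1 : ℤ) * (k - N) : ℤ) : ℂ) ≠ 0 := by exact_mod_cast h1
    simpa using h2

end GradedSl2

/-! ### The substitution action -/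

/-- The exponent of the monomial `x^(n-i) y^i`. -/
def formExp (n i : ℕ) : Fin 2 →₀ ℕ := Finsupp.single 0 (n - i) + Finsupp.single 1 i

/-- The linear substitution of the two variables given by a matrix. -/
def linSubst (g : Matrix (Fin 2) (Fin 2) ℂ) (j : Fin 2) : MvPolynomial (Fin 2) ℂ :=
  C (g j 0) * X 0 + C (g j 1) * X 1

theorem sl2Act_apply (n : ℕ) (g : Matrix.SpecialLinearGroup (Fin 2) ℂ) (a : Fin (n+1) → ℂ)
    (i : Fin (n+1)) :
    sl2Act n g a i = coeff (formExp n i) (bind₁ (linSubst g.1) (formPoly n a)) := by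
  have h1 : (fun j : Fin 2 => (C (g.1 j 0) * X 0 + C (g.1 j 1) * X 1 : MvPolynomial ℕ ℂ)) =
      fun j => rename Fin.val (linSubst g.1 j) := by
    funext j
    simp [linSubst]
  have h2 : (Finsupp.single 0 (n - (i : ℕ)) + Finsupp.single 1 (i : ℕ) : ℕ →₀ ℕ) =
      Finsupp.mapDomain Fin.val (formExp n i) := by
    rw [formExp, Finsupp.mapDomain_add, Finsupp.mapDomain_single, Finsupp.mapDomain_single]
    rfl
  unfold sl2Act
  rw [h1, h2, ← rename_bind₁, coeff_rename_mapDomain _ Fin.val_injective]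

theorem formPoly_eq_sum_monomial (n : ℕ) (a : Fin (n+1) → ℂ) :
    formPoly n a = ∑ i : Fin (n+1), monomial (formExp n i) (a i) := by
  refine Finset.sum_congr rfl fun i _ => ?_
  rw [formExp, ← mul_one (a i), ← monomial_mul, mul_one, X_pow_eq_monomial, X_pow_eq_monomial,
    C_mul_monomial, mul_one]

theorem formExp_eq_iff {n i : ℕ} (hi : i ≤ n) (μ : Fin 2 →₀ ℕ) :
    formExp n i = μ ↔ μ 0 + μ 1 = n ∧ μ 1 = i := by
  rw [Finsupp.ext_iff, Fin.forall_fin_two]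
  simp [formExp]
  omega

theorem coeff_formPoly (n : ℕ) (a : Fin (n+1) → ℂ) (μ : Fin 2 →₀ ℕ) :
    coeff μ (formPoly n a) =
      if h : μ 0 + μ 1 = n then a ⟨μ 1, by omega⟩ else 0 := by
  rw [formPoly_eq_sum_monomial, coeff_sum]
  simp only [coeff_monomial]
  split_ifs with h
  · rw [Finset.sum_eq_single ⟨μ 1, by omega⟩]
    · rw [if_pos]
      rw [formExp_eq_iff (by simp; omega)]
      exact ⟨h, rfl⟩
    · intro i _ hi
      rw [if_neg]
      rw [formExp_eq_iff (by omega)]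
      rintro ⟨-, h2⟩
      exact hi (Fin.ext h2.symm)
    · simp
  · refine Finset.sum_eq_zero fun i _ => if_neg ?_
    rw [formExp_eq_iff (by omega)]
    exact fun h' => h h'.1

theorem coeff_formExp_formPoly (n : ℕ) (a : Fin (n+1) → ℂ) (i : Fin (n+1)) :
    coeff (formExp n i) (formPoly n a) = a i := by
  have h := (formExp_eq_iff (n := n) (i := i) (by omega) _).1 rfl
  rw [coeff_formPoly, dif_pos h.1]
  congr 1
  exact Fin.ext h.2

theorem isHomogeneous_formPoly (n : ℕ) (a : Fin (n+1) → ℂ) : (formPoly n a).IsHomogeneous n := by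
  intro μ hμ
  rw [coeff_formPoly] at hμ
  have h1 : Finsupp.weight 1 μ = μ 0 + μ 1 := by
    simp [Finsupp.weight_apply, Finsupp.sum_fintype]
  rw [h1]
  by_contra h
  exact hμ (dif_neg h)

theorem formPoly_coeff {n : ℕ} {q : MvPolynomial (Fin 2) ℂ} (hq : q.IsHomogeneous n) :
    formPoly n (fun i => coeff (formExp n i) q) = q := by
  ext μ
  rw [coeff_formPoly]
  split_ifs with h
  · congr 1
    rw [formExp_eq_iff (by simp; omega)]
    exact ⟨h, rfl⟩
  · refine (hq.coeff_eq_zero ?_).symm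
    rwa [Finsupp.degree_eq_sum, Fin.sum_univ_two]

theorem isHomogeneous_linSubst (g : Matrix (Fin 2) (Fin 2) ℂ) (j : Fin 2) :
    (linSubst g j).IsHomogeneous 1 :=
  (isHomogeneous_C_mul_X _ _).add (isHomogeneous_C_mul_X _ _)

theorem formPoly_sl2Act (n : ℕ) (g : Matrix.SpecialLinearGroup (Fin 2) ℂ) (a : Fin (n+1) → ℂ) :
    formPoly n (sl2Act n g a) = bind₁ (linSubst g.1) (formPoly n a) := by
  have h : (bind₁ (linSubst g.1) (formPoly n a)).IsHomogeneous (1 * n) :=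
    (isHomogeneous_formPoly n a).aeval (linSubst g.1) (isHomogeneous_linSubst g.1)
  rw [one_mul] at h
  refine Eq.trans ?_ (formPoly_coeff h)
  congr 1
  funext i
  exact sl2Act_apply n g a i

theorem sl2Act_sl2Act (n : ℕ) (g h : Matrix.SpecialLinearGroup (Fin 2) ℂ) (a : Fin (n+1) → ℂ) :
    sl2Act n g (sl2Act n h a) = sl2Act n (h * g) a := by
  funext i
  rw [sl2Act_apply, formPoly_sl2Act, sl2Act_apply, bind₁_bind₁]
  congr 2
  congr 1
  funext j
  simp only [linSubst, map_add, map_mul, bind₁_X_right, bind₁_C_right,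
    Matrix.SpecialLinearGroup.coe_mul, Matrix.mul_apply, Fin.sum_univ_two]
  ring

theorem sl2Act_one (n : ℕ) (a : Fin (n+1) → ℂ) : sl2Act n 1 a = a := by
  funext i
  have : linSubst (1 : Matrix.SpecialLinearGroup (Fin 2) ℂ).1 = X := by
    funext j
    fin_cases j <;> simp [linSubst]
  rw [sl2Act_apply, this, bind₁_X_left, AlgHom.id_apply, coeff_formExp_formPoly]

/-- The unipotent matrix `x ↦ x + s y`. -/
def upperUnipotent (s : ℂ) : Matrix.SpecialLinearGroup (Fin 2) ℂ :=
  ⟨!![1, s; 0, 1], by simp [Matrix.det_fin_two]⟩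

/-- The unipotent matrix `y ↦ s x + y`. -/
def lowerUnipotent (s : ℂ) : Matrix.SpecialLinearGroup (Fin 2) ℂ :=
  ⟨!![1, 0; s, 1], by simp [Matrix.det_fin_two]⟩

theorem unipotent_decomposition (g : Matrix.SpecialLinearGroup (Fin 2) ℂ) (hg : g.1 1 0 ≠ 0) :
    g = upperUnipotent ((g.1 0 0 - 1) / g.1 1 0) * lowerUnipotent (g.1 1 0) *
      upperUnipotent ((g.1 1 1 - 1) / g.1 1 0) := by
  have hdet := g.2
  rw [Matrix.det_fin_two] at hdet
  ext i j
  rw [Matrix.SpecialLinearGroup.coe_mul, Matrix.SpecialLinearGroup.coe_mul]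
  fin_cases i <;> fin_cases j <;>
    simp [upperUnipotent, lowerUnipotent, Matrix.mul_apply, Fin.sum_univ_two] <;> field_simp <;>
    first
    | ring1
    | linear_combination hdet
    | linear_combination -hdet

/-- A submonoid of `SL(2,ℂ)` containing the elementary unipotent matrices is everything. -/
theorem unipotent_induction {S : Submonoid (Matrix.SpecialLinearGroup (Fin 2) ℂ)}
    (hu : ∀ s, upperUnipotent s ∈ S) (hl : ∀ s, lowerUnipotent s ∈ S)
    (g : Matrix.SpecialLinearGroup (Fin 2) ℂ) : g ∈ S := by
  have key (g : Matrix.SpecialLinearGroup (Fin 2) ℂ) (hg : g.1 1 0 ≠ 0) : g ∈ S := by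
    rw [unipotent_decomposition g hg]
    exact mul_mem (mul_mem (hu _) (hl _)) (hu _)
  by_cases hg : g.1 1 0 = 0
  · have hdet := g.2
    rw [Matrix.det_fin_two, hg, mul_zero, sub_zero] at hdet
    have h1 : (lowerUnipotent 1 * g).1 1 0 ≠ 0 := by
      rw [Matrix.SpecialLinearGroup.coe_mul]
      simpa [lowerUnipotent, Matrix.mul_apply, Fin.sum_univ_two, hg] using
        left_ne_zero_of_mul_eq_one hdet
    have h2 : g = lowerUnipotent (-1) * (lowerUnipotent 1 * g) := by
      rw [← mul_assoc]
      have : lowerUnipotent (-1) * lowerUnipotent 1 = 1 := by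
        ext i j
        rw [Matrix.SpecialLinearGroup.coe_mul]
        fin_cases i <;> fin_cases j <;>
          simp [lowerUnipotent, Matrix.mul_apply, Fin.sum_univ_two]
      rw [this, one_mul]
    rw [h2]
    exact mul_mem (hl _) (key _ h1)
  · exact key g hg

/-! ### Infinitesimal invariance -/

/-- The chain rule for coefficients of a substitution along a curve that satisfies a differential
equation given by a derivation. -/
theorem hasDerivAt_coeff_bind₁ {γ : ℂ → Fin 2 → MvPolynomial (Fin 2) ℂ}
    {V : Derivation ℂ (MvPolynomial (Fin 2) ℂ) (MvPolynomial (Fin 2) ℂ)} {s : ℂ}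
    (hγ : ∀ j μ, HasDerivAt (fun t => coeff μ (γ t j)) (coeff μ (V (γ s j))) s)
    (q : MvPolynomial (Fin 2) ℂ) :
    ∀ μ, HasDerivAt (fun t => coeff μ (bind₁ (γ t) q)) (coeff μ (V (bind₁ (γ s) q))) s := by
  induction q using MvPolynomial.induction_on with
  | C a =>
    intro μ
    simpa using hasDerivAt_const s (coeff μ (C a : MvPolynomial (Fin 2) ℂ))
  | add p q hp hq =>
    intro μ
    simp only [map_add, coeff_add]
    exact (hp μ).add (hq μ)
  | mul_X p j hp =>
    intro μ
    simp only [map_mul, bind₁_X_right, Derivation.leibniz, smul_eq_mul, coeff_add]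
    rw [add_comm, mul_comm (γ s j)]
    simp only [coeff_mul]
    rw [← Finset.sum_add_distrib]
    refine HasDerivAt.fun_sum fun x _ => ?_
    have := (hp x.1).mul (hγ j x.2)
    exact this

/-- The chain rule for a polynomial along an integral curve of a derivation. -/
theorem hasDerivAt_eval_curve {σ : Type*} {γ : ℂ → σ → ℂ}
    {D : Derivation ℂ (MvPolynomial σ ℂ) (MvPolynomial σ ℂ)} {s : ℂ}
    (hγ : ∀ i, HasDerivAt (fun t => γ t i) (eval (γ s) (D (X i))) s) (p : MvPolynomial σ ℂ) :
    HasDerivAt (fun t => eval (γ t) p) (eval (γ s) (D p)) s := by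
  induction p using MvPolynomial.induction_on with
  | C a => simpa using hasDerivAt_const s a
  | add p q hp hq =>
    simp only [map_add]
    exact hp.add hq
  | mul_X p i hp =>
    simp only [map_mul, eval_X, Derivation.leibniz, smul_eq_mul, map_add]
    rw [add_comm, mul_comm (γ s i)]
    exact hp.mul (hγ i)

/-- The infinitesimal generator of the action of the upper unipotent matrices. -/
def raiseDer (n : ℕ) : Derivation ℂ (MvPolynomial (Fin (n+1)) ℂ) (MvPolynomial (Fin (n+1)) ℂ) :=
  mkDerivation ℂ (Fin.cases 0 fun j : Fin n => C ((n : ℂ) - (j : ℕ)) * X j.castSucc)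

/-- The infinitesimal generator of the action of the lower unipotent matrices. -/
def lowerDer (n : ℕ) : Derivation ℂ (MvPolynomial (Fin (n+1)) ℂ) (MvPolynomial (Fin (n+1)) ℂ) :=
  mkDerivation ℂ (Fin.lastCases 0 fun j : Fin n => C (((j : ℕ) : ℂ) + 1) * X j.succ)

@[simp]
theorem raiseDer_X_zero (n : ℕ) : raiseDer n (X 0) = 0 := by
  simp [raiseDer]

@[simp]
theorem raiseDer_X_succ (n : ℕ) (j : Fin n) :
    raiseDer n (X j.succ) = C ((n : ℂ) - (j : ℕ)) * X j.castSucc := by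
  rw [raiseDer, mkDerivation_X, Fin.cases_succ]

@[simp]
theorem lowerDer_X_last (n : ℕ) : lowerDer n (X (Fin.last n)) = 0 := by
  simp [lowerDer]

@[simp]
theorem lowerDer_X_castSucc (n : ℕ) (j : Fin n) :
    lowerDer n (X j.castSucc) = C (((j : ℕ) : ℂ) + 1) * X j.succ := by
  rw [lowerDer, mkDerivation_X, Fin.lastCases_castSucc]

theorem formExp_apply_zero (n i : ℕ) : formExp n i 0 = n - i := by simp [formExp]

theorem formExp_apply_one (n i : ℕ) : formExp n i 1 = i := by simp [formExp]

theorem coeff_X_mul_pderiv_formPoly_upper (n : ℕ) (b : Fin (n+1) → ℂ) (i : Fin (n+1)) :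
    coeff (formExp n i) (X 1 * pderiv 0 (formPoly n b)) = eval b (raiseDer n (X i)) := by
  rw [coeff_X_mul']
  induction i using Fin.cases with
  | zero => simp [formExp]
  | succ j =>
    have h1 : (1 : Fin 2) ∈ (formExp n j.succ).support := by
      simp [formExp_apply_one]
    have h2 : formExp n j.succ - Finsupp.single 1 1 + Finsupp.single 0 1 =
        formExp n (j.castSucc : Fin (n+1)) := by
      refine Finsupp.ext fun k => ?_
      fin_cases k <;> simp [formExp] <;> omega
    rw [if_pos h1, coeff_pderiv, h2, coeff_formExp_formPoly]
    have h3 : (formExp n j.succ - Finsupp.single 1 1 : Fin 2 →₀ ℕ) 0 = n - (j + 1) := by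
      simp [formExp]
    rw [h3, raiseDer_X_succ, Nat.cast_sub (by omega)]
    simp
    ring

theorem coeff_X_mul_pderiv_formPoly_lower (n : ℕ) (b : Fin (n+1) → ℂ) (i : Fin (n+1)) :
    coeff (formExp n i) (X 0 * pderiv 1 (formPoly n b)) = eval b (lowerDer n (X i)) := by
  rw [coeff_X_mul']
  induction i using Fin.lastCases with
  | last => simp [formExp]
  | cast j =>
    have h1 : (0 : Fin 2) ∈ (formExp n (j.castSucc : Fin (n+1))).support := by
      simp [formExp_apply_zero, Nat.sub_eq_zero_iff_le]
    have h2 : formExp n (j.castSucc : Fin (n+1)) - Finsupp.single 0 1 + Finsupp.single 1 1 =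
        formExp n j.succ := by
      refine Finsupp.ext fun k => ?_
      fin_cases k <;> simp [formExp] <;> omega
    rw [if_pos h1, coeff_pderiv, h2, coeff_formExp_formPoly]
    have h3 : (formExp n (j.castSucc : Fin (n+1)) - Finsupp.single 0 1 : Fin 2 →₀ ℕ) 1 = j := by
      simp [formExp]
    rw [h3, lowerDer_X_castSucc]
    simp
    ring

theorem hasDerivAt_sl2Act {n : ℕ} {g : ℂ → Matrix.SpecialLinearGroup (Fin 2) ℂ}
    {V : Derivation ℂ (MvPolynomial (Fin 2) ℂ) (MvPolynomial (Fin 2) ℂ)}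
    {D : Derivation ℂ (MvPolynomial (Fin (n+1)) ℂ) (MvPolynomial (Fin (n+1)) ℂ)}
    (hV : ∀ s j μ, HasDerivAt (fun t => coeff μ (linSubst (g t).1 j))
      (coeff μ (V (linSubst (g s).1 j))) s)
    (hD : ∀ b (i : Fin (n+1)), coeff (formExp n i) (V (formPoly n b)) = eval b (D (X i)))
    (a : Fin (n+1) → ℂ) (s : ℂ) (p : MvPolynomial (Fin (n+1)) ℂ) :
    HasDerivAt (fun t => eval (sl2Act n (g t) a) p) (eval (sl2Act n (g s) a) (D p)) s := by
  refine hasDerivAt_eval_curve (fun i => ?_) p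
  rw [← hD, formPoly_sl2Act]
  simp only [sl2Act_apply]
  exact hasDerivAt_coeff_bind₁ (hV s) _ _

theorem forall_eval_sl2Act_eq_iff {n : ℕ} {g : ℂ → Matrix.SpecialLinearGroup (Fin 2) ℂ}
    {V : Derivation ℂ (MvPolynomial (Fin 2) ℂ) (MvPolynomial (Fin 2) ℂ)}
    {D : Derivation ℂ (MvPolynomial (Fin (n+1)) ℂ) (MvPolynomial (Fin (n+1)) ℂ)}
    (h0 : g 0 = 1)
    (hV : ∀ s j μ, HasDerivAt (fun t => coeff μ (linSubst (g t).1 j))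
      (coeff μ (V (linSubst (g s).1 j))) s)
    (hD : ∀ b (i : Fin (n+1)), coeff (formExp n i) (V (formPoly n b)) = eval b (D (X i)))
    (p : MvPolynomial (Fin (n+1)) ℂ) :
    (∀ s a, eval (sl2Act n (g s) a) p = eval a p) ↔ D p = 0 := by
  have hder := hasDerivAt_sl2Act hV hD
  constructor
  · intro h
    refine MvPolynomial.funext fun a => ?_
    have h1 := hder a 0 p
    simp only [h] at h1
    rw [h0, sl2Act_one] at h1
    rw [map_zero]
    exact h1.unique (hasDerivAt_const _ _)
  · intro h s a
    have h1 := is_const_of_deriv_eq_zero (f := fun t => eval (sl2Act n (g t) a) p)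
      (fun t => (hder a t p).differentiableAt)
      (fun t => by rw [(hder a t p).deriv, h, map_zero]) s 0
    simpa [h0, sl2Act_one] using h1

theorem hasDerivAt_add_mul_coeff (c d : ℂ) (s : ℂ) :
    HasDerivAt (fun t => c + t * d) d s := by
  simpa using ((hasDerivAt_id s).mul_const d).const_add c

theorem upperUnipotent_invariant_iff (n : ℕ) (p : MvPolynomial (Fin (n+1)) ℂ) :
    (∀ s a, eval (sl2Act n (upperUnipotent s) a) p = eval a p) ↔ raiseDer n p = 0 := by
  refine forall_eval_sl2Act_eq_iff (V := (X 1 : MvPolynomial (Fin 2) ℂ) • pderiv 0) ?_ ?_ ?_ p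
  · ext i j
    fin_cases i <;> fin_cases j <;> simp [upperUnipotent]
  · intro s j μ
    fin_cases j
    · simpa [linSubst, upperUnipotent, coeff_C_mul] using
        hasDerivAt_add_mul_coeff (coeff μ (X 0 : MvPolynomial (Fin 2) ℂ)) (coeff μ (X 1)) s
    · simpa [linSubst, upperUnipotent] using hasDerivAt_const s _
  · exact coeff_X_mul_pderiv_formPoly_upper n

theorem lowerUnipotent_invariant_iff (n : ℕ) (p : MvPolynomial (Fin (n+1)) ℂ) :
    (∀ s a, eval (sl2Act n (lowerUnipotent s) a) p = eval a p) ↔ lowerDer n p = 0 := by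
  refine forall_eval_sl2Act_eq_iff (V := (X 0 : MvPolynomial (Fin 2) ℂ) • pderiv 1) ?_ ?_ ?_ p
  · ext i j
    fin_cases i <;> fin_cases j <;> simp [lowerUnipotent]
  · intro s j μ
    fin_cases j
    · simpa [linSubst, lowerUnipotent] using hasDerivAt_const s _
    · simpa [linSubst, lowerUnipotent, coeff_C_mul, add_comm] using
        hasDerivAt_add_mul_coeff (coeff μ (X 1 : MvPolynomial (Fin 2) ℂ)) (coeff μ (X 0)) s
  · exact coeff_X_mul_pderiv_formPoly_lower n

/-- A polynomial is invariant if and only if it is annihilated by both generators. -/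
theorem mem_invariantRing_iff (n : ℕ) (p : MvPolynomial (Fin (n+1)) ℂ) :
    p ∈ invariantRing n ↔ raiseDer n p = 0 ∧ lowerDer n p = 0 := by
  rw [← upperUnipotent_invariant_iff, ← lowerUnipotent_invariant_iff]
  change (∀ g a, eval (sl2Act n g a) p = eval a p) ↔ _
  constructor
  · exact fun h => ⟨fun s => h _, fun s => h _⟩
  · rintro ⟨hu, hl⟩ g
    let S : Submonoid (Matrix.SpecialLinearGroup (Fin 2) ℂ) :=
      { carrier := {g | ∀ a, eval (sl2Act n g a) p = eval a p}
        one_mem' := fun a => by rw [sl2Act_one]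
        mul_mem' := fun {g h} hg hh a => by
          rw [← sl2Act_sl2Act]
          exact (hh _).trans (hg a) }
    exact unipotent_induction (S := S) hu hl g

/-! ### Weight spaces and the dimension formula -/

theorem derivation_C_mul_apply {σ : Type*} (D : Derivation ℂ (MvPolynomial σ ℂ) (MvPolynomial σ ℂ))
    (r : ℂ) (p : MvPolynomial σ ℂ) : D (C r * p) = C r * D p := by
  rw [C_mul', D.map_smul, C_mul']

theorem derivation_sum_apply {σ ι : Type*} (s : Finset ι)
    (D : ι → Derivation ℂ (MvPolynomial σ ℂ) (MvPolynomial σ ℂ)) (p : MvPolynomial σ ℂ) :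
    (∑ i ∈ s, D i) p = ∑ i ∈ s, D i p := by
  classical
  induction s using Finset.induction_on with
  | empty => simp
  | insert i s hi ih => rw [Finset.sum_insert hi, Finset.sum_insert hi, Derivation.add_apply, ih]

theorem Derivation.isWeightedHomogeneous_of_X {σ M : Type*} [AddCommMonoid M] {w : σ → M}
    {D : Derivation ℂ (MvPolynomial σ ℂ) (MvPolynomial σ ℂ)} {δ : M}
    (h : ∀ i, IsWeightedHomogeneous w (D (X i)) (w i + δ)) {p : MvPolynomial σ ℂ} {μ : M}
    (hp : IsWeightedHomogeneous w p μ) : IsWeightedHomogeneous w (D p) (μ + δ) := by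
  have key (d : σ →₀ ℕ) :
      IsWeightedHomogeneous w (D (monomial d (1 : ℂ))) (Finsupp.weight w d + δ) := by
    induction d using Finsupp.induction_linear with
    | zero =>
      rw [show (monomial 0 (1 : ℂ) : MvPolynomial σ ℂ) = C 1 from rfl, derivation_C]
      exact isWeightedHomogeneous_zero _ _ _
    | add d e hd he =>
      have hmul : (monomial (d + e) (1 : ℂ) : MvPolynomial σ ℂ) = monomial d 1 * monomial e 1 := by
        rw [monomial_mul, one_mul]
      rw [hmul, Derivation.leibniz, smul_eq_mul, smul_eq_mul, map_add]
      have h1 := (isWeightedHomogeneous_monomial (R := ℂ) w d 1 rfl).mul he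
      have h2 := (isWeightedHomogeneous_monomial (R := ℂ) w e 1 rfl).mul hd
      rw [← add_assoc] at h1 h2
      rw [add_comm (Finsupp.weight w e)] at h2
      exact h1.add h2
    | single i k =>
      induction k with
      | zero =>
        rw [Finsupp.single_zero, show (monomial 0 (1 : ℂ) : MvPolynomial σ ℂ) = C 1 from rfl,
          derivation_C]
        exact isWeightedHomogeneous_zero _ _ _
      | succ k ih =>
        have hmul : (monomial (Finsupp.single i (k + 1)) (1 : ℂ) : MvPolynomial σ ℂ) =
            monomial (Finsupp.single i k) 1 * X i := by
          rw [X, monomial_mul, one_mul, Finsupp.single_add]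
        rw [hmul, Derivation.leibniz, smul_eq_mul, smul_eq_mul, Finsupp.single_add, map_add]
        have h1 := (isWeightedHomogeneous_monomial (R := ℂ) w (Finsupp.single i k) 1 rfl).mul (h i)
        have h2 := (isWeightedHomogeneous_X ℂ w i).mul ih
        have h3 : Finsupp.weight w (Finsupp.single i 1) = w i := by
          rw [Finsupp.weight_single, one_smul]
        rw [h3]
        rw [← add_assoc] at h1 h2
        rw [add_comm (w i)] at h2
        exact h1.add h2
  induction hp using IsWeightedHomogeneous.induction_on with
  | zero => rw [map_zero]; exact isWeightedHomogeneous_zero _ _ _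
  | add p q _ _ hp hq => rw [map_add]; exact hp.add hq
  | monomial d r hr =>
    rw [← hr, ← mul_one r, ← C_mul_monomial, derivation_C_mul_apply]
    exact (key d).C_mul r

/-- The bidegree of the coefficient `a_i`: its degree and its `sl₂`-weight `n - 2 i`. -/
def formWeight (n : ℕ) (i : Fin (n+1)) : ℕ × ℤ := (1, n - 2 * (i : ℕ))

/-- The space of polynomials of degree `m` and `sl₂`-weight `k`. -/
def weightSpace (n m : ℕ) (k : ℤ) : Submodule ℂ (MvPolynomial (Fin (n+1)) ℂ) :=
  weightedHomogeneousSubmodule ℂ (formWeight n) (m, k)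

theorem weight_formWeight (n : ℕ) (d : Fin (n+1) →₀ ℕ) :
    Finsupp.weight (formWeight n) d = (∑ i, d i, ∑ i, d i * ((n : ℤ) - 2 * (i : ℕ))) := by
  rw [Finsupp.weight_apply, Finsupp.sum_fintype _ _ (by simp)]
  ext <;> simp [formWeight, Prod.fst_sum, Prod.snd_sum]

theorem raiseDer_mem_weightSpace (n m : ℕ) (k : ℤ) (p : MvPolynomial (Fin (n+1)) ℂ)
    (hp : p ∈ weightSpace n m k) : raiseDer n p ∈ weightSpace n m (k + 2) := by
  refine Derivation.isWeightedHomogeneous_of_X (δ := ((0, 2) : ℕ × ℤ)) (fun i => ?_) hp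
  induction i using Fin.cases with
  | zero => rw [raiseDer_X_zero]; exact isWeightedHomogeneous_zero _ _ _
  | succ j =>
    rw [raiseDer_X_succ]
    have h := (isWeightedHomogeneous_X ℂ (formWeight n) j.castSucc).C_mul ((n : ℂ) - (j : ℕ))
    convert h using 1
    simp [formWeight]
    ring

theorem lowerDer_mem_weightSpace (n m : ℕ) (k : ℤ) (p : MvPolynomial (Fin (n+1)) ℂ)
    (hp : p ∈ weightSpace n m k) : lowerDer n p ∈ weightSpace n m (k - 2) := by
  refine Derivation.isWeightedHomogeneous_of_X (δ := ((0, -2) : ℕ × ℤ)) (fun i => ?_) hp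
  induction i using Fin.lastCases with
  | last => rw [lowerDer_X_last]; exact isWeightedHomogeneous_zero _ _ _
  | cast j =>
    rw [lowerDer_X_castSucc]
    have h := (isWeightedHomogeneous_X ℂ (formWeight n) j.succ).C_mul (((j : ℕ) : ℂ) + 1)
    convert h using 1
    simp [formWeight]
    ring

theorem raiseDer_lowerDer_X (n : ℕ) (i : Fin (n+1)) :
    raiseDer n (lowerDer n (X i)) = C ((((i : ℕ) : ℂ) + 1) * (n - (i : ℕ))) * X i := by
  induction i using Fin.lastCases with
  | last => simp
  | cast j =>
    rw [lowerDer_X_castSucc, derivation_C_mul_apply, raiseDer_X_succ, ← mul_assoc,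
      ← C_mul]
    rfl

theorem lowerDer_raiseDer_X (n : ℕ) (i : Fin (n+1)) :
    lowerDer n (raiseDer n (X i)) = C (((n : ℂ) - (i : ℕ) + 1) * (i : ℕ)) * X i := by
  induction i using Fin.cases with
  | zero => simp
  | succ j =>
    rw [raiseDer_X_succ, derivation_C_mul_apply, lowerDer_X_castSucc, ← mul_assoc,
      ← C_mul]
    congr 2
    push_cast [Fin.val_succ]
    ring

theorem coeff_diagonal_derivation {σ : Type*} [Fintype σ]
    {D : Derivation ℂ (MvPolynomial σ ℂ) (MvPolynomial σ ℂ)} {c : σ → ℂ}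
    (hD : ∀ i, D (X i) = C (c i) * X i) (p : MvPolynomial σ ℂ) (d : σ →₀ ℕ) :
    coeff d (D p) = (∑ i, d i * c i) * coeff d p := by
  classical
  have h : D = ∑ i, (C (c i) * X i : MvPolynomial σ ℂ) • pderiv i := by
    refine derivation_ext fun j => ?_
    simp only [hD, derivation_sum_apply, Derivation.smul_apply, smul_eq_mul]
    rw [Finset.sum_eq_single j]
    · simp
    · intro i _ hij
      rw [pderiv_X_of_ne hij.symm, mul_zero]
    · simp
  induction p using MvPolynomial.induction_on' with
  | monomial s a =>
    simp only [h, derivation_sum_apply, Derivation.smul_apply, smul_eq_mul,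
      mul_assoc, X_mul_pderiv_monomial, coeff_sum, coeff_C_mul, coeff_smul, coeff_monomial]
    split_ifs with hs
    · subst hs
      rw [Finset.sum_mul]
      refine Finset.sum_congr rfl fun i _ => ?_
      rw [nsmul_eq_mul]
      ring
    · simp
  | add p q hp hq => rw [map_add, coeff_add, hp, hq, coeff_add, mul_add]

theorem coeff_commutator (n : ℕ) (p : MvPolynomial (Fin (n+1)) ℂ) (d : Fin (n+1) →₀ ℕ) :
    coeff d (raiseDer n (lowerDer n p) - lowerDer n (raiseDer n p)) =
      ((Finsupp.weight (formWeight n) d).2 : ℂ) * coeff d p := by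
  rw [← Derivation.commutator_apply, coeff_diagonal_derivation
    (c := fun i : Fin (n+1) => (n : ℂ) - 2 * (i : ℕ)), weight_formWeight]
  · push_cast
    rfl
  · intro i
    rw [Derivation.commutator_apply, raiseDer_lowerDer_X, lowerDer_raiseDer_X, ← sub_mul, ← C_sub]
    congr 2
    ring

theorem raiseDer_lowerDer (n m : ℕ) (k : ℤ) (p : MvPolynomial (Fin (n+1)) ℂ)
    (hp : p ∈ weightSpace n m k) :
    raiseDer n (lowerDer n p) = lowerDer n (raiseDer n p) + (k : ℂ) • p := by
  rw [← sub_eq_iff_eq_add']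
  refine MvPolynomial.ext _ _ fun d => ?_
  rw [coeff_commutator, coeff_smul, smul_eq_mul]
  by_cases h : coeff d p = 0
  · rw [h, mul_zero, mul_zero]
  · rw [hp h]

theorem mem_weightSpace_eq_zero (n m : ℕ) (k : ℤ) (hk : (n * m : ℤ) < |k|)
    (p : MvPolynomial (Fin (n+1)) ℂ) (hp : p ∈ weightSpace n m k) : p = 0 := by
  refine MvPolynomial.ext _ _ fun d => ?_
  rw [coeff_zero]
  by_contra h
  have h1 := hp h
  rw [weight_formWeight, Prod.mk.injEq] at h1
  refine absurd hk (not_lt.mpr ?_)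
  rw [← h1.2, ← h1.1]
  refine (Finset.abs_sum_le_sum_abs _ _).trans ?_
  push_cast
  rw [Finset.mul_sum]
  refine Finset.sum_le_sum fun i _ => ?_
  rw [abs_mul, Nat.abs_cast, mul_comm]
  have h3 : |(n : ℤ) - 2 * (i : ℕ)| ≤ n := by
    have := i.2
    rw [abs_le]
    omega
  exact mul_le_mul_of_nonneg_right h3 (by positivity)

theorem raiseDer_pow_eq_zero (n m : ℕ) (k : ℤ) (p : MvPolynomial (Fin (n+1)) ℂ)
    (hp : p ∈ weightSpace n m k) :
    ∃ N : ℕ, ((raiseDer n : MvPolynomial (Fin (n+1)) ℂ →ₗ[ℂ] MvPolynomial (Fin (n+1)) ℂ) ^ N) p = 0 := by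
  have hmem (N : ℕ) : ((raiseDer n : MvPolynomial (Fin (n+1)) ℂ →ₗ[ℂ] MvPolynomial (Fin (n+1)) ℂ) ^ N) p ∈
      weightSpace n m (k + 2 * N) := by
    induction N with
    | zero => simpa using hp
    | succ N ih =>
      rw [pow_succ', Module.End.mul_apply]
      have h : k + 2 * ((N + 1 : ℕ) : ℤ) = k + 2 * N + 2 := by
        push_cast
        ring
      rw [h]
      exact raiseDer_mem_weightSpace n m _ _ ih
  refine ⟨(n * m + |k| + 1).toNat, mem_weightSpace_eq_zero n m _ ?_ _ (hmem _)⟩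
  have h1 : (0 : ℤ) ≤ n * m := by positivity
  have h2 := neg_abs_le k
  rw [Int.toNat_of_nonneg (by positivity)]
  exact lt_of_lt_of_le (by linarith [abs_nonneg k]) (le_abs_self _)

theorem lowerDer_pow_eq_zero (n m : ℕ) (k : ℤ) (p : MvPolynomial (Fin (n+1)) ℂ)
    (hp : p ∈ weightSpace n m k) :
    ∃ N : ℕ, ((lowerDer n : MvPolynomial (Fin (n+1)) ℂ →ₗ[ℂ] MvPolynomial (Fin (n+1)) ℂ) ^ N) p = 0 := by
  have hmem (N : ℕ) : ((lowerDer n : MvPolynomial (Fin (n+1)) ℂ →ₗ[ℂ] MvPolynomial (Fin (n+1)) ℂ) ^ N) p ∈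
      weightSpace n m (k - 2 * N) := by
    induction N with
    | zero => simpa using hp
    | succ N ih =>
      rw [pow_succ', Module.End.mul_apply]
      have h : k - 2 * ((N + 1 : ℕ) : ℤ) = k - 2 * N - 2 := by
        push_cast
        ring
      rw [h]
      exact lowerDer_mem_weightSpace n m _ _ ih
  refine ⟨(n * m + |k| + 1).toNat, mem_weightSpace_eq_zero n m _ ?_ _ (hmem _)⟩
  have h1 : (0 : ℤ) ≤ n * m := by positivity
  have h2 := le_abs_self k
  rw [Int.toNat_of_nonneg (by positivity)]
  exact lt_of_lt_of_le (by linarith [abs_nonneg k]) (neg_le_abs _)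

theorem mem_invariantSpace_iff (n m : ℕ) (p : MvPolynomial (Fin (n+1)) ℂ) :
    p ∈ invariantSpace n m ↔ p ∈ weightSpace n m 0 ∧ raiseDer n p = 0 := by
  rw [invariantSpace, Submodule.mem_inf, Subalgebra.mem_toSubmodule, mem_invariantRing_iff,
    mem_homogeneousSubmodule]
  constructor
  · rintro ⟨⟨h1, h2⟩, h3⟩
    refine ⟨fun d hd => ?_, h1⟩
    have h4 := coeff_commutator n p d
    rw [h1, h2, map_zero, map_zero, sub_zero, coeff_zero, zero_eq_mul, or_iff_left hd,
      Int.cast_eq_zero] at h4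
    refine Prod.ext ?_ h4
    have h5 := h3 hd
    rw [weight_formWeight]
    simpa [Finsupp.weight_apply, Finsupp.sum_fintype] using h5
  · rintro ⟨h1, h2⟩
    refine ⟨⟨h2, ?_⟩, fun d hd => ?_⟩
    · have h3 := lowerDer_mem_weightSpace n m 0 p h1
      obtain ⟨N, hN⟩ := lowerDer_pow_eq_zero n m _ _ h3
      refine sl2_raise_injective (W := weightSpace n m)
        (E := (raiseDer n : MvPolynomial (Fin (n+1)) ℂ →ₗ[ℂ] MvPolynomial (Fin (n+1)) ℂ))
        (F := (lowerDer n : MvPolynomial (Fin (n+1)) ℂ →ₗ[ℂ] MvPolynomial (Fin (n+1)) ℂ))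
        (lowerDer_mem_weightSpace n m) (raiseDer_lowerDer n m) (by norm_num) h3 ?_ N hN
      have h4 := raiseDer_lowerDer n m 0 p h1
      rw [h2, map_zero, Int.cast_zero, zero_smul, add_zero] at h4
      exact h4
    · have h5 := congrArg Prod.fst (h1 hd)
      rw [weight_formWeight] at h5
      simpa [Finsupp.weight_apply, Finsupp.sum_fintype] using h5

theorem finite_weight_eq (n m : ℕ) (k : ℤ) :
    Finite {d : Fin (n+1) →₀ ℕ | Finsupp.weight (formWeight n) d = (m, k)} := by
  refine Set.Finite.subset (Finset.finite_toSet
    (Finset.finsuppAntidiag (Finset.univ : Finset (Fin (n+1))) m)) fun d hd => ?_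
  have h := congrArg Prod.fst hd
  rw [weight_formWeight] at h
  simpa using h

/-- The linear equivalence of a weight space with the functions on its monomials. -/
def weightSpaceEquiv (n m : ℕ) (k : ℤ) :
    weightSpace n m k ≃ₗ[ℂ]
      ({d : Fin (n+1) →₀ ℕ | Finsupp.weight (formWeight n) d = (m, k)} →₀ ℂ) :=
  (LinearEquiv.ofEq _ _ (weightedHomogeneousSubmodule_eq_finsupp_supported ℂ (formWeight n) (m, k))).trans
    (AddMonoidAlgebra.supportedEquivFinsupp _)

theorem finrank_weightSpace (n m : ℕ) (k : ℤ) :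
    Module.finrank ℂ (weightSpace n m k) =
      Nat.card {d : Fin (n+1) →₀ ℕ | Finsupp.weight (formWeight n) d = (m, k)} := by
  have := finite_weight_eq n m k
  have := Fintype.ofFinite {d : Fin (n+1) →₀ ℕ | Finsupp.weight (formWeight n) d = (m, k)}
  rw [(weightSpaceEquiv n m k).finrank_eq, Module.finrank_finsupp_self, Nat.card_eq_fintype_card]

/-- The dimension of the space of invariants is the difference of the dimensions of the weight
spaces of weights `0` and `2`. -/
theorem hdim_eq_card_sub_card (n m : ℕ) :
    (hdim n m : ℤ) =
      Nat.card {d : Fin (n+1) →₀ ℕ | Finsupp.weight (formWeight n) d = (m, 0)} -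
      Nat.card {d : Fin (n+1) →₀ ℕ | Finsupp.weight (formWeight n) d = (m, 2)} := by
  let L : weightSpace n m 0 →ₗ[ℂ] weightSpace n m 2 :=
    (raiseDer n : MvPolynomial (Fin (n+1)) ℂ →ₗ[ℂ] MvPolynomial (Fin (n+1)) ℂ).restrict (raiseDer_mem_weightSpace n m 0)
  have hL : Function.Surjective L := by
    rintro ⟨v, hv⟩
    obtain ⟨N, hN⟩ := raiseDer_pow_eq_zero n m 2 v hv
    obtain ⟨u, hu, huv⟩ := sl2_raise_surjective (W := weightSpace n m)
      (E := (raiseDer n : MvPolynomial (Fin (n+1)) ℂ →ₗ[ℂ] MvPolynomial (Fin (n+1)) ℂ))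
      (F := (lowerDer n : MvPolynomial (Fin (n+1)) ℂ →ₗ[ℂ] MvPolynomial (Fin (n+1)) ℂ))
      (raiseDer_mem_weightSpace n m) (lowerDer_mem_weightSpace n m) (raiseDer_lowerDer n m)
      (by norm_num) N v hv hN
    exact ⟨⟨u, hu⟩, Subtype.ext huv⟩
  have hker : invariantSpace n m = (LinearMap.ker L).map (weightSpace n m 0).subtype := by
    ext p
    rw [mem_invariantSpace_iff]
    simp [L, LinearMap.restrict_apply, and_comm]
  have := finite_weight_eq n m 0
  have : Module.Finite ℂ (weightSpace n m 0) := Module.Finite.equiv (weightSpaceEquiv n m 0).symm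
  have h := L.finrank_range_add_finrank_ker
  rw [LinearMap.range_eq_top.mpr hL, finrank_top] at h
  rw [hdim, hker, ← finrank_weightSpace, ← finrank_weightSpace, ← h,
    Submodule.finrank_map_subtype_eq]
  push_cast
  ring

/-! ### Counting monomials of given degree and weight -/

/-- The generating polynomial, as a power series, of the monomials of degree `m` in the variables
`a_0, …, a_n`, counted by the sum of their indices. -/
def gaussSeries (n m : ℕ) : PowerSeries ℚ :=
  ∑ e ∈ Finset.Nat.antidiagonalTuple (n + 1) m, PowerSeries.X ^ (∑ i : Fin (n+1), (i : ℕ) * e i)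

theorem gaussSeries_zero_left (m : ℕ) : gaussSeries 0 m = 1 := by
  simp [gaussSeries]

theorem gaussSeries_zero_right (n : ℕ) : gaussSeries n 0 = 1 := by
  simp [gaussSeries, Finset.Nat.antidiagonalTuple_zero_right]

theorem gaussSeries_succ_succ (n m : ℕ) :
    gaussSeries (n + 1) (m + 1) =
      gaussSeries (n + 1) m + PowerSeries.X ^ (m + 1) * gaussSeries n (m + 1) := by
  rw [gaussSeries, ← Finset.sum_filter_add_sum_filter_not _ (fun e => e 0 ≠ 0)]
  congr 1
  · refine Finset.sum_nbij' (fun e => Fin.cons (e 0 - 1) (Fin.tail e))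
      (fun e => Fin.cons (e 0 + 1) (Fin.tail e)) ?_ ?_ ?_ ?_ ?_
    · intro e he
      simp only [Finset.mem_filter, Finset.Nat.mem_antidiagonalTuple, Fin.sum_univ_succ (n := n + 1),
        Fin.cons_zero, Fin.cons_succ, Fin.tail] at he ⊢
      omega
    · intro e he
      simp only [Finset.mem_filter, Finset.Nat.mem_antidiagonalTuple, Fin.sum_univ_succ (n := n + 1),
        Fin.cons_zero, Fin.cons_succ, Fin.tail] at he ⊢
      omega
    · intro e he
      rw [Finset.mem_filter] at he
      rw [Fin.cons_zero, Fin.tail_cons, Nat.sub_add_cancel (Nat.pos_of_ne_zero he.2),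
        Fin.cons_self_tail]
    · intro e _
      rw [Fin.cons_zero, Fin.tail_cons, Nat.add_sub_cancel, Fin.cons_self_tail]
    · intro e _
      simp only [Fin.sum_univ_succ (n := n + 1), Fin.val_zero, zero_mul, Fin.cons_succ, Fin.tail]
  · rw [gaussSeries, Finset.mul_sum]
    refine Finset.sum_nbij' Fin.tail (fun e => Fin.cons 0 e) ?_ ?_ ?_ ?_ ?_
    · intro e he
      simp only [Finset.mem_filter, Finset.Nat.mem_antidiagonalTuple, Fin.sum_univ_succ (n := n + 1),
        Fin.tail, not_not] at he ⊢
      rw [← he.1, he.2, zero_add]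
    · intro e he
      simp only [Finset.mem_filter, Finset.Nat.mem_antidiagonalTuple, Fin.sum_univ_succ (n := n + 1),
        Fin.cons_zero, Fin.cons_succ, not_not] at he ⊢
      exact ⟨(zero_add _).trans he, trivial⟩
    · intro e he
      simp only [Finset.mem_filter, not_not] at he
      conv_rhs => rw [← Fin.cons_self_tail e, he.2]
    · intro e _
      rw [Fin.tail_cons]
    · intro e he
      simp only [Finset.mem_filter, Finset.Nat.mem_antidiagonalTuple, Fin.sum_univ_succ (n := n + 1),
        not_not] at he
      rw [← pow_add, Fin.sum_univ_succ (n := n + 1)]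
      congr 1
      simp only [Fin.val_zero, zero_mul, zero_add, Fin.val_succ, add_mul, one_mul,
        Finset.sum_add_distrib, Fin.tail]
      rw [he.2, zero_add, and_iff_left rfl] at he
      rw [he, add_comm]

/-- The `q`-Pochhammer symbol `(1 - q) (1 - q ^ 2) ⋯ (1 - q ^ k)`. -/
def qPoch (k : ℕ) : PowerSeries ℚ :=
  ∏ l ∈ Finset.range k, (1 - PowerSeries.X ^ (l + 1))

theorem qPoch_succ (k : ℕ) : qPoch (k + 1) = qPoch k * (1 - PowerSeries.X ^ (k + 1)) :=
  Finset.prod_range_succ _ _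

theorem qPoch_zero : qPoch 0 = 1 := rfl

theorem gaussSeries_mul_qPoch (n m : ℕ) :
    gaussSeries n m * qPoch n = ∏ k ∈ Finset.range n, (1 - PowerSeries.X ^ (m + k + 1)) := by
  induction n generalizing m with
  | zero => simp [gaussSeries_zero_left, qPoch_zero]
  | succ n ihn =>
    induction m with
    | zero => simp [gaussSeries_zero_right, qPoch]
    | succ m ihm =>
      have h1 : gaussSeries (n + 1) m * qPoch (n + 1) = (1 - PowerSeries.X ^ (m + 1)) *
          ∏ k ∈ Finset.range n, (1 - PowerSeries.X ^ (m + 1 + k + 1)) := by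
        rw [ihm, Finset.prod_range_succ', mul_comm, add_zero]
        simp only [add_assoc, add_comm 1]
      rw [gaussSeries_succ_succ, add_mul, h1, Finset.prod_range_succ, ← ihn (m + 1), qPoch_succ]
      ring

theorem weight_formWeight_eq_iff (n m : ℕ) (k : ℤ) (d : Fin (n+1) →₀ ℕ) :
    Finsupp.weight (formWeight n) d = (m, k) ↔
      ∑ i, d i = m ∧ (n * m : ℤ) - 2 * ((∑ i : Fin (n+1), (i : ℕ) * d i : ℕ) : ℤ) = k := by
  rw [weight_formWeight, Prod.mk.injEq]
  refine and_congr_right fun h => ?_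
  rw [← h]
  push_cast
  rw [Finset.mul_sum, Finset.mul_sum, ← Finset.sum_sub_distrib]
  rw [Finset.sum_congr rfl fun i _ => (by ring :
    (d i : ℤ) * ((n : ℤ) - 2 * ((i : ℕ) : ℤ)) = n * d i - 2 * (((i : ℕ) : ℤ) * d i))]

theorem card_weight_eq_coeff (n m w : ℕ) (k : ℤ) (h : (n * m : ℤ) - 2 * w = k) :
    (Nat.card {d : Fin (n+1) →₀ ℕ | Finsupp.weight (formWeight n) d = (m, k)} : ℚ) =
      PowerSeries.coeff w (gaussSeries n m) := by
  classical
  rw [gaussSeries, map_sum]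
  simp only [PowerSeries.coeff_X_pow]
  rw [Finset.sum_boole, Nat.cast_inj, ← Nat.card_eq_finsetCard]
  refine Nat.card_congr (Finsupp.equivFunOnFinite.subtypeEquiv fun d => ?_)
  rw [Finset.mem_filter, Finset.Nat.mem_antidiagonalTuple]
  refine (weight_formWeight_eq_iff n m k d).trans (and_congr_right fun _ => ?_)
  simp only [Finsupp.equivFunOnFinite_apply]
  omega

theorem hdim_of_odd (n m : ℕ) (h : Odd (n * m)) : hdim n m = 0 := by
  have h0 (k : ℤ) (hk : Even k) :
      {d : Fin (n+1) →₀ ℕ | Finsupp.weight (formWeight n) d = (m, k)} = ∅ := by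
    refine Set.eq_empty_of_forall_notMem fun d hd => ?_
    rw [Set.mem_ofPred_eq, weight_formWeight_eq_iff] at hd
    obtain ⟨a, ha⟩ := h
    obtain ⟨b, hb⟩ := hk
    have : (n * m : ℤ) = 2 * a + 1 := by exact_mod_cast ha
    omega
  have h1 := hdim_eq_card_sub_card n m
  rw [h0 0 (by decide), h0 2 (by decide)] at h1
  simpa using h1

theorem hdim_eq_coeff (n m w : ℕ) (h : n * m = 2 * w) :
    (hdim n m : ℚ) = PowerSeries.coeff w ((1 - PowerSeries.X) * gaussSeries n m) := by
  have h' : (n * m : ℤ) = 2 * w := by exact_mod_cast h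
  have h1 := congrArg (Int.cast : ℤ → ℚ) (hdim_eq_card_sub_card n m)
  rw [Int.cast_natCast] at h1
  rw [h1, sub_mul, one_mul, map_sub]
  push_cast
  rw [card_weight_eq_coeff n m w 0 (by omega)]
  congr 1
  cases w with
  | zero =>
    rw [PowerSeries.coeff_zero_X_mul, Nat.cast_eq_zero, Nat.card_eq_zero]
    left
    rw [Set.isEmpty_coe_sort]
    refine Set.eq_empty_of_forall_notMem fun d hd => ?_
    rw [Set.mem_ofPred_eq, weight_formWeight_eq_iff] at hd
    omega
  | succ w =>
    rw [PowerSeries.coeff_succ_X_mul, card_weight_eq_coeff n m w 2 (by push_cast at h'; omega)]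

/-! ### The `q`-binomial theorem -/

theorem constantCoeff_qPoch (k : ℕ) : PowerSeries.constantCoeff (qPoch k) = 1 := by
  simp [qPoch, map_prod]

theorem qPoch_mul_inv (k : ℕ) : qPoch k * (qPoch k)⁻¹ = 1 :=
  PowerSeries.mul_inv_cancel _ (by rw [constantCoeff_qPoch]; exact one_ne_zero)

theorem inv_qPoch_succ_mul (k : ℕ) :
    (qPoch (k + 1))⁻¹ * (1 - PowerSeries.X ^ (k + 1)) = (qPoch k)⁻¹ := by
  have h1 := qPoch_mul_inv (k + 1)
  have h2 := qPoch_mul_inv k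
  rw [qPoch_succ] at h1 ⊢
  linear_combination (qPoch k)⁻¹ * h1 -
    (qPoch k * (1 - PowerSeries.X ^ (k + 1)))⁻¹ * (1 - PowerSeries.X ^ (k + 1)) * h2

theorem prod_one_sub_mul_inv_qPoch (x : PowerSeries ℚ) (n : ℕ) :
    (∏ k ∈ Finset.range n, (1 - x * PowerSeries.X ^ (k + 1))) * (qPoch n)⁻¹ =
      ∑ p ∈ Finset.HasAntidiagonal.antidiagonal n, (-1) ^ p.1 * x ^ p.1 * PowerSeries.X ^ (p.1 + 1).choose 2 *
        (qPoch p.1)⁻¹ * (qPoch p.2)⁻¹ := by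
  induction n with
  | zero => simp [qPoch_zero]
  | succ n ih =>
    have hne : (1 - PowerSeries.X ^ (n + 1) : PowerSeries ℚ) ≠ 0 := by
      intro h
      have := congrArg PowerSeries.constantCoeff h
      simp at this
    refine mul_right_cancel₀ hne ?_
    rw [mul_assoc, inv_qPoch_succ_mul, Finset.prod_range_succ, mul_right_comm, ih, Finset.sum_mul]
    have h1 : ∀ p ∈ Finset.HasAntidiagonal.antidiagonal (n + 1),
        (-1) ^ p.1 * x ^ p.1 * PowerSeries.X ^ (p.1 + 1).choose 2 *
          (qPoch p.1)⁻¹ * (qPoch p.2)⁻¹ * (1 - PowerSeries.X ^ (n + 1)) =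
        (-1) ^ p.1 * x ^ p.1 * PowerSeries.X ^ (p.1 + 1).choose 2 *
          (qPoch p.1)⁻¹ * ((qPoch p.2)⁻¹ * (1 - PowerSeries.X ^ p.2)) +
        (-1) ^ p.1 * x ^ p.1 * PowerSeries.X ^ ((p.1 + 1).choose 2 + p.2) *
          ((qPoch p.1)⁻¹ * (1 - PowerSeries.X ^ p.1)) * (qPoch p.2)⁻¹ := by
      intro p hp
      rw [← Finset.HasAntidiagonal.mem_antidiagonal.mp hp]
      ring
    rw [Finset.sum_mul, Finset.sum_congr rfl h1, Finset.sum_add_distrib,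
      Finset.Nat.sum_antidiagonal_succ', Finset.Nat.sum_antidiagonal_succ]
    simp only [pow_zero, sub_self, mul_zero, zero_mul, zero_add, inv_qPoch_succ_mul]
    rw [← Finset.sum_add_distrib]
    refine Finset.sum_congr rfl fun p hp => ?_
    have h2 : (p.1 + 1 + 1).choose 2 + p.2 = (p.1 + 1).choose 2 + (n + 1) := by
      rw [Nat.choose_succ_succ' (p.1 + 1) 1, Nat.choose_one_right,
        ← Finset.HasAntidiagonal.mem_antidiagonal.mp hp]
      ring
    rw [h2]
    ring

theorem gaussSeries_eq_sum (n m : ℕ) :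
    gaussSeries n m = ∑ p ∈ Finset.HasAntidiagonal.antidiagonal n, (-1) ^ p.1 *
      (PowerSeries.X ^ (m * p.1) * (PowerSeries.X ^ (p.1 + 1).choose 2 *
        (qPoch p.1)⁻¹ * (qPoch p.2)⁻¹)) := by
  have h := prod_one_sub_mul_inv_qPoch (PowerSeries.X ^ m) n
  simp only [← pow_add, ← add_assoc] at h
  rw [← gaussSeries_mul_qPoch, mul_assoc, qPoch_mul_inv, mul_one] at h
  rw [h]
  refine Finset.sum_congr rfl fun p _ => ?_
  rw [pow_mul]
  ring

/-- The power series whose coefficients, along an arithmetic progression, give the contribution of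
`j` to the dimensions of the spaces of invariants. -/
def invariantTerm (n j : ℕ) : PowerSeries ℚ :=
  (1 - PowerSeries.X) * (PowerSeries.X ^ (j + 1).choose 2 * (qPoch j)⁻¹ * (qPoch (n - j))⁻¹)

theorem hdim_eq_sum (n m w : ℕ) (hn : n ≠ 0) (h : n * m = 2 * w) :
    (hdim n m : ℚ) = ∑ j ∈ (Finset.range (n + 1)).filter (fun j => 2 * j < n),
      (-1) ^ j * PowerSeries.coeff (w - m * j) (invariantTerm n j) := by
  rw [hdim_eq_coeff n m w h, gaussSeries_eq_sum, Finset.Nat.sum_antidiagonal_eq_sum_range_succ_mk,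
    Finset.mul_sum, map_sum, Finset.sum_filter]
  refine Finset.sum_congr rfl fun j _ => ?_
  have h1 : (1 - PowerSeries.X : PowerSeries ℚ) * ((-1) ^ j * (PowerSeries.X ^ (m * j) *
      (PowerSeries.X ^ (j + 1).choose 2 * (qPoch j)⁻¹ * (qPoch (n - j))⁻¹))) =
      PowerSeries.C ((-1) ^ j) * (PowerSeries.X ^ (m * j) * invariantTerm n j) := by
    rw [invariantTerm, map_pow, map_neg, map_one]
    ring
  rw [h1, PowerSeries.coeff_C_mul, PowerSeries.coeff_X_pow_mul']
  split_ifs with h2 h3 h3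
  · rfl
  · have h4 : w - m * j = 0 := by nlinarith [Nat.sub_add_cancel h2]
    have h5 : 0 < (j + 1).choose 2 := Nat.choose_pos (by omega)
    rw [h4, invariantTerm, PowerSeries.coeff_zero_eq_constantCoeff_apply]
    simp [h5.ne']
  · exfalso
    nlinarith
  · rw [mul_zero]

/-! ### Divisibility of products of cyclotomic polynomials -/

theorem prod_range_X_pow_sub_one (j n : ℕ) (hj : j ≤ n) :
    ∏ k ∈ Finset.range j, ((Polynomial.X : Polynomial ℚ) ^ (k + 1) - 1) =
      ∏ e ∈ Finset.Ioc 0 n, Polynomial.cyclotomic e ℚ ^ (j / e) := by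
  have h1 : ∏ k ∈ Finset.range j, ((Polynomial.X : Polynomial ℚ) ^ (k + 1) - 1) =
      ∏ k ∈ Finset.Ioc 0 j, ((Polynomial.X : Polynomial ℚ) ^ k - 1) := by
    refine Finset.prod_nbij' (· + 1) (· - 1) ?_ ?_ ?_ ?_ (fun _ _ => rfl) <;>
      simp only [Finset.mem_range, Finset.mem_Ioc] <;> intros <;> omega
  have h2 : ∀ k ∈ Finset.Ioc 0 j, ((Polynomial.X : Polynomial ℚ) ^ k - 1) =
      ∏ e ∈ Finset.Ioc 0 n, if e ∣ k then Polynomial.cyclotomic e ℚ else 1 := by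
    intro k hk
    rw [Finset.mem_Ioc] at hk
    rw [← Polynomial.prod_cyclotomic_eq_X_pow_sub_one hk.1, ← Finset.prod_filter]
    refine Finset.prod_congr ?_ fun _ _ => rfl
    ext e
    simp only [Nat.mem_divisors, Finset.mem_filter, Finset.mem_Ioc]
    refine ⟨fun h => ⟨⟨Nat.pos_of_dvd_of_pos h.1 hk.1, ?_⟩, h.1⟩, fun h => ⟨h.2, hk.1.ne'⟩⟩
    exact (Nat.le_of_dvd hk.1 h.1).trans (hk.2.trans hj)
  rw [h1, Finset.prod_congr rfl h2, Finset.prod_comm]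
  refine Finset.prod_congr rfl fun e _ => ?_
  rw [← Finset.prod_filter, Finset.prod_const, Nat.Ioc_filter_dvd_card_eq_div]

theorem prod_cyclotomic_dvd {ι : Type*} [Fintype ι] (a : ι → ℕ) (ha : ∀ i, 0 < a i) (n : ℕ) :
    ∏ e ∈ Finset.Ioc 0 n, Polynomial.cyclotomic e ℚ ^
      (Finset.univ.filter fun i => e ∣ a i).card ∣
    ∏ i, ((Polynomial.X : Polynomial ℚ) ^ a i - 1) := by
  have h : ∏ e ∈ Finset.Ioc 0 n, Polynomial.cyclotomic e ℚ ^
      (Finset.univ.filter fun i => e ∣ a i).card =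
      ∏ i, ∏ e ∈ (Finset.Ioc 0 n).filter (· ∣ a i), Polynomial.cyclotomic e ℚ := by
    simp_rw [Finset.prod_filter]
    rw [Finset.prod_comm]
    refine Finset.prod_congr rfl fun e _ => ?_
    rw [← Finset.prod_filter, Finset.prod_const]
  rw [h]
  refine Finset.prod_dvd_prod_of_dvd _ _ fun i _ => ?_
  rw [← Polynomial.prod_cyclotomic_eq_X_pow_sub_one (ha i)]
  refine Finset.prod_dvd_prod_of_subset _ _ _ fun e he => ?_
  rw [Finset.mem_filter] at he
  exact Nat.mem_divisors.mpr ⟨he.2, (ha i).ne'⟩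

theorem prod_X_pow_sub_one_dvd {ι : Type*} [Fintype ι] (j l : ℕ) (a : ι → ℕ) (ha : ∀ i, 0 < a i)
    (h1 : j + l ≤ Fintype.card ι + 2)
    (h : ∀ e, 2 ≤ e → j / e + l / e ≤ (Finset.univ.filter fun i => e ∣ a i).card) :
    (∏ k ∈ Finset.range j, ((Polynomial.X : Polynomial ℚ) ^ (k + 1) - 1)) *
      ∏ k ∈ Finset.range l, ((Polynomial.X : Polynomial ℚ) ^ (k + 1) - 1) ∣
    (Polynomial.X - 1) ^ 2 * ∏ i, ((Polynomial.X : Polynomial ℚ) ^ a i - 1) := by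
  rw [prod_range_X_pow_sub_one j (j + l + 1) (by omega),
    prod_range_X_pow_sub_one l (j + l + 1) (by omega), ← Finset.prod_mul_distrib]
  refine dvd_trans ?_ (mul_dvd_mul_left _ (prod_cyclotomic_dvd a ha (j + l + 1)))
  have h0 : 1 ∈ Finset.Ioc 0 (j + l + 1) := by simp
  rw [← Finset.mul_prod_erase _ _ h0, ← Finset.mul_prod_erase _ _ h0, ← mul_assoc,
    Polynomial.cyclotomic_one, ← pow_add, ← pow_add]
  refine mul_dvd_mul (pow_dvd_pow _ ?_) (Finset.prod_dvd_prod_of_dvd _ _ fun e he => ?_)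
  · simpa [add_comm 2] using h1
  · rw [← pow_add]
    refine pow_dvd_pow _ (h e ?_)
    simp only [Finset.mem_erase, Finset.mem_Ioc] at he
    omega

theorem prod_one_sub_X_pow {ι : Type*} (s : Finset ι) (a : ι → ℕ) :
    ∏ i ∈ s, (1 - (Polynomial.X : Polynomial ℚ) ^ a i) =
      (-1) ^ s.card * ∏ i ∈ s, ((Polynomial.X : Polynomial ℚ) ^ a i - 1) := by
  rw [← Finset.prod_const, ← Finset.prod_mul_distrib]
  exact Finset.prod_congr rfl fun i _ => by ring

theorem prod_one_sub_X_pow_dvd {ι : Type*} [Fintype ι] (j l : ℕ) (a : ι → ℕ) (ha : ∀ i, 0 < a i)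
    (h1 : j + l ≤ Fintype.card ι + 2)
    (h : ∀ e, 2 ≤ e → j / e + l / e ≤ (Finset.univ.filter fun i => e ∣ a i).card) :
    (∏ k ∈ Finset.range j, (1 - (Polynomial.X : Polynomial ℚ) ^ (k + 1))) *
      ∏ k ∈ Finset.range l, (1 - (Polynomial.X : Polynomial ℚ) ^ (k + 1)) ∣
    (1 - Polynomial.X) ^ 2 * ∏ i, (1 - (Polynomial.X : Polynomial ℚ) ^ a i) := by
  have hu (k : ℕ) : IsUnit ((-1 : Polynomial ℚ) ^ k) := isUnit_one.neg.pow k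
  rw [prod_one_sub_X_pow, prod_one_sub_X_pow, prod_one_sub_X_pow, mul_mul_mul_comm,
    ((hu _).mul (hu _)).mul_left_dvd, mul_left_comm, (hu _).dvd_mul_left,
    ← neg_sub Polynomial.X 1, neg_sq]
  exact prod_X_pow_sub_one_dvd j l a ha h1 h

theorem prod_one_sub_X_pow_eq_geom {ι : Type*} (s : Finset ι) (a : ι → ℕ) :
    ∏ i ∈ s, (1 - (Polynomial.X : Polynomial ℚ) ^ a i) =
      (1 - Polynomial.X) ^ s.card * ∏ i ∈ s, ∑ k ∈ Finset.range (a i), Polynomial.X ^ k := by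
  rw [← Finset.prod_const, ← Finset.prod_mul_distrib]
  exact Finset.prod_congr rfl fun i _ => (mul_neg_geom_sum _ _).symm

/-! ### Power series with eventually constant coefficients -/

theorem eventually_coeff_eq_eval_one (F : PowerSeries ℚ) (Q : Polynomial ℚ)
    (h : (1 - PowerSeries.X) * F = (Q : PowerSeries ℚ)) :
    ∀ᶠ m in Filter.atTop, PowerSeries.coeff m F = Q.eval 1 := by
  have hF : F = (Q : PowerSeries ℚ) * PowerSeries.mk 1 := by
    rw [← h, mul_right_comm, mul_comm (1 - PowerSeries.X),
      PowerSeries.mk_one_mul_one_sub_eq_one, one_mul]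
  filter_upwards [Filter.eventually_ge_atTop Q.natDegree] with m hm
  rw [hF, PowerSeries.coeff_mul, Finset.Nat.sum_antidiagonal_eq_sum_range_succ_mk,
    Polynomial.eval_eq_sum_range' (Nat.lt_succ_of_le hm)]
  simp

/-- The power series formed by the coefficients of `F` at the multiples of `δ`. -/
def decimate (δ : ℕ) (F : PowerSeries ℚ) : PowerSeries ℚ :=
  PowerSeries.mk fun m => PowerSeries.coeff (δ * m) F

theorem coeff_decimate (δ m : ℕ) (F : PowerSeries ℚ) :
    PowerSeries.coeff m (decimate δ F) = PowerSeries.coeff (δ * m) F := PowerSeries.coeff_mk _ _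

theorem decimate_one_sub_X_pow_mul (δ D : ℕ) (hδ : 0 < δ) (F : PowerSeries ℚ) :
    decimate δ ((1 - PowerSeries.X ^ (δ * D)) * F) =
      (1 - PowerSeries.X ^ D) * decimate δ F := by
  ext m
  rw [coeff_decimate, sub_mul, sub_mul, one_mul, one_mul, map_sub, map_sub, coeff_decimate,
    PowerSeries.coeff_X_pow_mul', PowerSeries.coeff_X_pow_mul', coeff_decimate, Nat.mul_sub]
  simp only [Nat.mul_le_mul_left_iff hδ]

theorem decimate_prod_mul {ι : Type*} (s : Finset ι) (δ : ℕ) (hδ : 0 < δ) (D : ι → ℕ)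
    (F : PowerSeries ℚ) :
    decimate δ ((∏ i ∈ s, (1 - PowerSeries.X ^ (δ * D i))) * F) =
      (∏ i ∈ s, (1 - PowerSeries.X ^ D i)) * decimate δ F := by
  classical
  induction s using Finset.induction_on with
  | empty => simp
  | insert i s hi ih =>
    rw [Finset.prod_insert hi, Finset.prod_insert hi, mul_assoc, decimate_one_sub_X_pow_mul _ _ hδ,
      ih, mul_assoc]

theorem eventually_coeff_decimate {F : PowerSeries ℚ} {c : ℚ} {δ : ℕ} (hδ : 0 < δ)
    (h : ∀ᶠ m in Filter.atTop, PowerSeries.coeff m F = c) :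
    ∀ᶠ m in Filter.atTop, PowerSeries.coeff m (decimate δ F) = c := by
  simp only [coeff_decimate]
  exact (Filter.tendsto_id.const_mul_atTop' hδ).eventually h

/-! ### Asymptotics of the terms -/

theorem coe_prod_one_sub_X_pow {ι : Type*} (s : Finset ι) (a : ι → ℕ) :
    ((∏ i ∈ s, (1 - (Polynomial.X : Polynomial ℚ) ^ a i) : Polynomial ℚ) : PowerSeries ℚ) =
      ∏ i ∈ s, (1 - PowerSeries.X ^ a i) := by
  rw [← Polynomial.coeToPowerSeries.ringHom_apply, map_prod]
  simp

theorem eval_one_prod_geom {ι : Type*} (s : Finset ι) (a : ι → ℕ) :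
    (∏ i ∈ s, ∑ k ∈ Finset.range (a i), (Polynomial.X : Polynomial ℚ) ^ k).eval 1 =
      ∏ i ∈ s, (a i : ℚ) := by
  simp [Polynomial.eval_prod, Polynomial.eval_finsetSum]

theorem eventually_coeff_invariantTerm {ι : Type*} [Fintype ι] (n j : ℕ) (hj : j ≤ n)
    (hn : Fintype.card ι + 2 = n) (a : ι → ℕ) (ha : ∀ i, 0 < a i)
    (h : ∀ e, 2 ≤ e → j / e + (n - j) / e ≤ (Finset.univ.filter fun i => e ∣ a i).card) :
    ∀ᶠ m in Filter.atTop, PowerSeries.coeff m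
      ((∏ i, (1 - PowerSeries.X ^ a i)) * invariantTerm n j) =
        (∏ i, (a i : ℚ)) / (j.factorial * (n - j).factorial) := by
  obtain ⟨Q, hQ⟩ := prod_one_sub_X_pow_dvd j (n - j) a ha (by omega) h
  have heval : Q.eval 1 = (∏ i, (a i : ℚ)) / (j.factorial * (n - j).factorial) := by
    have h1 := hQ
    rw [prod_one_sub_X_pow_eq_geom, prod_one_sub_X_pow_eq_geom, prod_one_sub_X_pow_eq_geom,
      ← mul_assoc, ← pow_add, mul_mul_mul_comm, ← pow_add, Finset.card_range, Finset.card_range,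
      Finset.card_univ, Nat.add_sub_cancel' hj, add_comm 2, hn, mul_assoc] at h1
    have hne : (1 - Polynomial.X : Polynomial ℚ) ^ n ≠ 0 := by
      refine pow_ne_zero _ fun h0 => ?_
      have := congrArg (Polynomial.eval 0) h0
      simp at this
    have h2 := congrArg (Polynomial.eval 1) (mul_left_cancel₀ hne h1)
    rw [Polynomial.eval_mul, Polynomial.eval_mul, eval_one_prod_geom, eval_one_prod_geom,
      eval_one_prod_geom, ← Nat.cast_prod, ← Nat.cast_prod (R := ℚ) _ (Finset.range j),
      ← Nat.cast_prod (R := ℚ) _ (Finset.range (n - j)),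
      Finset.prod_range_add_one_eq_factorial, Finset.prod_range_add_one_eq_factorial,
      Nat.cast_prod] at h2
    rw [h2, mul_div_cancel_left₀]
    positivity
  have hQ' := congrArg (fun p : Polynomial ℚ => (p : PowerSeries ℚ)) hQ
  simp only [Polynomial.coe_mul, Polynomial.coe_pow, Polynomial.coe_sub, Polynomial.coe_one,
    Polynomial.coe_X, coe_prod_one_sub_X_pow] at hQ'
  have key : (1 - PowerSeries.X) * ((∏ i, (1 - PowerSeries.X ^ a i)) * invariantTerm n j) =
      ((Polynomial.X ^ (j + 1).choose 2 * Q : Polynomial ℚ) : PowerSeries ℚ) := by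
    rw [Polynomial.coe_mul, Polynomial.coe_pow, Polynomial.coe_X, invariantTerm]
    have h1 := qPoch_mul_inv j
    have h2 := qPoch_mul_inv (n - j)
    change _ = qPoch j * qPoch (n - j) * (Q : PowerSeries ℚ) at hQ'
    linear_combination (PowerSeries.X ^ (j + 1).choose 2 * (qPoch j)⁻¹ * (qPoch (n - j))⁻¹) * hQ' +
      PowerSeries.X ^ (j + 1).choose 2 * (Q : PowerSeries ℚ) *
        (h1 * qPoch (n - j) * (qPoch (n - j))⁻¹ + h2)
  have := eventually_coeff_eq_eval_one _ _ key
  rwa [Polynomial.eval_mul, Polynomial.eval_pow, Polynomial.eval_X, one_pow, one_mul, heval] at this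

theorem sum_alternating_pow_eq_zero (n : ℕ) (hn : 2 ≤ n) :
    ∑ j ∈ Finset.range (n + 1), (-1) ^ j * ((n : ℚ) - 2 * j) ^ (n - 2) /
      (j.factorial * (n - j).factorial) = 0 := by
  have hdeg : ((Polynomial.C (n : ℚ) - 2 * Polynomial.X) ^ (n - 2)).natDegree < n := by
    have h : ((Polynomial.C (n : ℚ) - 2 * Polynomial.X) ^ (n - 2)).natDegree ≤ (n - 2) * 1 := by
      refine Polynomial.natDegree_pow_le_of_le _ ?_
      compute_degree
    omega
  have h := congrFun (Polynomial.fwdDiff_iter_eq_zero_of_degree_lt hdeg) 0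
  rw [fwdDiff_iter_eq_sum_shift, Pi.zero_apply] at h
  have h2 : ∑ j ∈ Finset.range (n + 1), (-1) ^ j * ((n : ℚ) - 2 * j) ^ (n - 2) /
      (j.factorial * (n - j).factorial) = (-1) ^ n / n.factorial * 0 := by
    rw [← h, Finset.mul_sum]
    refine Finset.sum_congr rfl fun j hj => ?_
    have hj' : j ≤ n := Nat.lt_succ_iff.mp (Finset.mem_range.mp hj)
    have h3 : (-1 : ℚ) ^ n * (-1) ^ (n - j) = (-1) ^ j := by
      rw [← pow_add, show n + (n - j) = j + 2 * (n - j) by omega, pow_add, pow_mul]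
      simp
    have h4 : (n.choose j : ℚ) = n.factorial / (j.factorial * (n - j).factorial) :=
      Nat.cast_choose ℚ hj'
    have h5 : (n.factorial : ℚ) ≠ 0 := by positivity
    rw [zsmul_eq_mul]
    push_cast
    rw [h4, ← h3]
    simp only [nsmul_eq_mul, mul_one, zero_add, Polynomial.eval_pow, Polynomial.eval_sub,
      Polynomial.eval_C, Polynomial.eval_mul, Polynomial.eval_ofNat, Polynomial.eval_X]
    field_simp
  rw [h2, mul_zero]

theorem half_sum_alternating_pow_eq_zero (n : ℕ) (hn : 3 ≤ n) :
    ∑ j ∈ (Finset.range (n + 1)).filter (fun j => 2 * j < n),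
      (-1) ^ j * ((n : ℚ) - 2 * j) ^ (n - 2) / (j.factorial * (n - j).factorial) = 0 := by
  set f : ℕ → ℚ := fun j => (-1) ^ j * ((n : ℚ) - 2 * j) ^ (n - 2) /
    (j.factorial * (n - j).factorial) with hf
  have hflip (j : ℕ) (hj : j ≤ n) : f (n - j) = f j := by
    have h1 : ((n : ℚ) - 2 * (n - j)) ^ (n - 2) = (-1) ^ (n - 2) * (n - 2 * j) ^ (n - 2) := by
      rw [← mul_pow]
      ring
    have h2 : (-1 : ℚ) ^ (n - j) * (-1) ^ (n - 2) = (-1) ^ j := by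
      rw [← pow_add]
      exact neg_one_pow_congr (by rw [Nat.even_iff, Nat.even_iff]; omega)
    simp only [hf]
    rw [Nat.sub_sub_self hj, Nat.cast_sub hj, h1, ← h2]
    ring
  have hsplit : ∑ j ∈ Finset.range (n + 1), f j =
      ∑ j ∈ Finset.range (n + 1), (if 2 * j < n then f j else 0) +
      ∑ j ∈ Finset.range (n + 1), (if 2 * (n - j) < n then f (n - j) else 0) := by
    rw [← Finset.sum_add_distrib]
    refine Finset.sum_congr rfl fun j hj => ?_
    have hj' : j ≤ n := Nat.lt_succ_iff.mp (Finset.mem_range.mp hj)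
    rw [hflip j hj']
    rcases lt_trichotomy (2 * j) n with h | h | h
    · rw [if_pos h, if_neg (by omega), add_zero]
    · rw [if_neg (by omega), if_neg (by omega), add_zero]
      have h1 : (n : ℚ) - 2 * j = 0 := by
        rw [← h]
        push_cast
        ring
      simp only [hf]
      rw [h1, zero_pow (by omega), mul_zero, zero_div]
    · rw [if_neg (by omega), if_pos (by omega), zero_add]
  rw [Finset.sum_flip (fun j => if 2 * j < n then f j else 0), ← Finset.sum_filter,
    sum_alternating_pow_eq_zero n (by omega)] at hsplit
  linarith

/-! ### The Poincaré series -/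

theorem eventually_coeff_sum {ι : Type*} (s : Finset ι) (F : ι → PowerSeries ℚ) (c : ι → ℚ)
    (h : ∀ i ∈ s, ∀ᶠ m in Filter.atTop, PowerSeries.coeff m (F i) = c i) :
    ∀ᶠ m in Filter.atTop, PowerSeries.coeff m (∑ i ∈ s, F i) = ∑ i ∈ s, c i := by
  filter_upwards [(Filter.eventually_all_finset s).mpr h] with m hm
  rw [map_sum]
  exact Finset.sum_congr rfl hm

theorem eventually_coeff_poincare {ι : Type*} [Fintype ι] (n κ N : ℕ) (hn : 3 ≤ n) (hκ : 0 < κ)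
    (hN : n * κ = 2 * N) (hι : Fintype.card ι + 2 = n) (D : ι → ℕ) (hD : ∀ i, 0 < D i)
    (h : ∀ j, 2 * j < n → ∀ e, 2 ≤ e →
      j / e + (n - j) / e ≤ (Finset.univ.filter fun i => e ∣ (N - κ * j) * D i).card) :
    ∀ᶠ m in Filter.atTop, PowerSeries.coeff m
      ((∏ i, (1 - PowerSeries.X ^ D i)) * PowerSeries.mk fun m => (hdim n (κ * m) : ℚ)) = 0 := by
  set s := (Finset.range (n + 1)).filter (fun j => 2 * j < n) with hs
  have hmem : ∀ j ∈ s, 2 * j < n := fun j hj => (Finset.mem_filter.mp hj).2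
  have hδ : ∀ j ∈ s, 0 < N - κ * j := fun j hj => by
    have h1 := hmem j hj
    have : κ * j < N := by nlinarith
    omega
  have hP : (PowerSeries.mk fun m => (hdim n (κ * m) : ℚ)) =
      ∑ j ∈ s, PowerSeries.C ((-1) ^ j) * decimate (N - κ * j) (invariantTerm n j) := by
    ext m
    rw [PowerSeries.coeff_mk, map_sum,
      hdim_eq_sum n (κ * m) (N * m) (by omega) (by rw [← mul_assoc, hN, mul_assoc])]
    refine Finset.sum_congr rfl fun j _ => ?_
    rw [PowerSeries.coeff_C_mul, coeff_decimate, Nat.sub_mul, mul_right_comm κ m j]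
  have hc : ∑ j ∈ s, (-1) ^ j * ((∏ i, (((N - κ * j) * D i : ℕ) : ℚ)) /
      (j.factorial * (n - j).factorial)) = 0 := by
    have h0 := half_sum_alternating_pow_eq_zero n hn
    rw [← mul_zero (((κ : ℚ) / 2) ^ (n - 2) * ∏ i, (D i : ℚ)), ← h0, Finset.mul_sum]
    refine Finset.sum_congr rfl fun j hj => ?_
    have h1 : ((N - κ * j : ℕ) : ℚ) = κ / 2 * (n - 2 * j) := by
      rw [Nat.cast_sub (by have := hδ j hj; omega)]
      have : (n * κ : ℚ) = 2 * N := by exact_mod_cast hN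
      push_cast
      linear_combination -this / 2
    simp only [Nat.cast_mul]
    rw [Finset.prod_mul_distrib, h1, Finset.prod_const, Finset.card_univ, mul_pow,
      show Fintype.card ι = n - 2 by omega]
    ring
  rw [hP, Finset.mul_sum, ← hc]
  refine eventually_coeff_sum s _ _ fun j hj => ?_
  have h1 := eventually_coeff_invariantTerm n j (by have := hmem j hj; omega) hι
    (fun i => (N - κ * j) * D i) (fun i => Nat.mul_pos (hδ j hj) (hD i)) (h j (hmem j hj))
  filter_upwards [eventually_coeff_decimate (hδ j hj) h1] with m hm
  rw [decimate_prod_mul _ _ (hδ j hj)] at hm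
  rw [mul_left_comm, PowerSeries.coeff_C_mul, hm]

theorem exists_polynomial_of_eventually_coeff_eq_zero {R : Type*} [CommRing R] (F : PowerSeries R)
    (h : ∀ᶠ m in Filter.atTop, PowerSeries.coeff m F = 0) :
    ∃ q : Polynomial R, F = (q : PowerSeries R) := by
  obtain ⟨N, hN⟩ := Filter.eventually_atTop.mp h
  refine ⟨PowerSeries.trunc N F, ?_⟩
  ext m
  rw [Polynomial.coeff_coe, PowerSeries.coeff_trunc]
  split_ifs with hm
  · rfl
  · exact hN m (not_lt.mp hm)

theorem div_eq_pred_div_of_not_dvd {e j : ℕ} (h : ¬ e ∣ j) : j / e = (j - 1) / e := by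
  obtain _ | j := j
  · rfl
  · rw [Nat.succ_div_of_not_dvd h, Nat.add_sub_cancel]

theorem div_add_div_le_card_filter {ι : Type*} [Fintype ι] (n j δ e : ℕ) (D : ι → ℕ)
    (hn : 3 ≤ n) (hι : Fintype.card ι + 2 = n) (he : 2 ≤ e) (hj : 2 * j < n)
    (hδ : δ = n - 2 * j ∨ 2 * δ = n - 2 * j)
    (h1 : (n - 1) / e ≤ (Finset.univ.filter fun i => e ∣ D i).card)
    (h2 : Even n → (n - 1) / 2 ≤ (Finset.univ.filter fun i => 2 ∣ D i).card)
    (h3 : n % 4 = 2 → n / 2 ≤ (Finset.univ.filter fun i => 2 ∣ D i).card) :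
    j / e + (n - j) / e ≤ (Finset.univ.filter fun i => e ∣ δ * D i).card := by
  have h1' : (n - 1) / e ≤ (Finset.univ.filter fun i => e ∣ δ * D i).card :=
    h1.trans (Finset.card_le_card (Finset.monotone_filter_right _ fun i _ hi => hi.mul_left _))
  by_cases hej : e ∣ j
  swap
  · refine le_trans ?_ h1'
    have hj0 : j ≠ 0 := fun h0 => hej (h0 ▸ dvd_zero e)
    have h4 := Nat.div_add_div_le_add_div (x := (j - 1)) (y := (n - j)) (z := e)
    rwa [← div_eq_pred_div_of_not_dvd hej, show j - 1 + (n - j) = n - 1 by omega] at h4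
  by_cases hen : e ∣ n - j
  swap
  · refine le_trans ?_ h1'
    have h4 := Nat.div_add_div_le_add_div (x := j) (y := (n - j - 1)) (z := e)
    rwa [← div_eq_pred_div_of_not_dvd hen, show j + (n - j - 1) = n - 1 by omega] at h4
  have hsub : e ∣ n - 2 * j := by
    rw [two_mul, ← Nat.sub_sub]
    exact Nat.dvd_sub hen hej
  have hle : j / e + (n - j) / e ≤ n / e := by
    have h4 := Nat.div_add_div_le_add_div (x := j) (y := (n - j)) (z := e)
    rwa [Nat.add_sub_cancel' (by omega)] at h4
  refine hle.trans ?_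
  by_cases heδ : e ∣ δ
  · rw [Finset.filter_true_of_mem fun i _ => heδ.mul_right _, Finset.card_univ]
    have h4 : n / e ≤ n / 2 := Nat.div_le_div_left he (by norm_num)
    omega
  rcases hδ with rfl | hδ
  · exact absurd hsub heδ
  rw [← hδ] at hsub
  obtain ⟨f, rfl⟩ : 2 ∣ e := by
    by_contra h4
    exact heδ (((Nat.prime_two.coprime_iff_not_dvd.mpr h4).symm.dvd_of_dvd_mul_left) hsub)
  have hf : f ∣ δ := Nat.dvd_of_mul_dvd_mul_left (by norm_num) hsub
  have h4 : (Finset.univ.filter fun i => 2 ∣ D i).card ≤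
      (Finset.univ.filter fun i => 2 * f ∣ δ * D i).card := by
    refine Finset.card_le_card (Finset.monotone_filter_right _ fun i _ hi => ?_)
    rw [mul_comm 2 f]
    exact mul_dvd_mul hf hi
  refine le_trans ?_ h4
  by_cases hf1 : f = 1
  · subst hf1
    refine h3 ?_
    omega
  · refine le_trans ?_ (h2 (Nat.even_iff.mpr (by omega)))
    have h5 : n / (2 * f) ≤ n / 4 := Nat.div_le_div_left (by omega) (by norm_num)
    omega

theorem coeff_prod_mul_of_odd {ι : Type*} (s : Finset ι) (D : ι → ℕ) (F : PowerSeries ℚ)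
    (hF : ∀ m, Odd m → PowerSeries.coeff m F = 0) (m : ℕ) (hm : Odd m) :
    PowerSeries.coeff m ((∏ i ∈ s, (1 - PowerSeries.X ^ (2 * D i))) * F) = 0 := by
  classical
  induction s using Finset.induction_on generalizing m with
  | empty => simpa using hF m hm
  | insert i s hi ih =>
    rw [Finset.prod_insert hi, mul_assoc, sub_mul, one_mul, map_sub, ih m hm,
      PowerSeries.coeff_X_pow_mul', zero_sub, neg_eq_zero]
    split_ifs with h
    · exact ih _ (Nat.Odd.sub_even h hm (even_two_mul _))
    · rfl

theorem eventually_coeff_poincare_of_even (n : ℕ) (hn : 3 ≤ n) (hpar : Even n)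
    (d : Fin (n-2) → ℕ) (hd : ∀ i, 0 < d i)
    (h1 : ∀ t : ℕ, 1 < t → (n - 1) / t ≤ (Finset.univ.filter fun i => t ∣ d i).card)
    (h2 : n % 4 = 2 → n / 2 ≤ (Finset.univ.filter fun i => 2 ∣ d i).card) :
    ∀ᶠ m in Filter.atTop, PowerSeries.coeff m
      ((∏ i, (1 - PowerSeries.X ^ d i)) * PowerSeries.mk fun m => (hdim n m : ℚ)) = 0 := by
  have hc : Fintype.card (Fin (n - 2)) + 2 = n := by
    rw [Fintype.card_fin]
    omega
  have hn2 := Nat.even_iff.mp hpar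
  have h := eventually_coeff_poincare n 1 (n / 2) hn one_pos (by omega) hc d hd
    fun j hj e he => div_add_div_le_card_filter n j _ e d hn hc he hj (Or.inr (by omega)) (h1 e he)
      (fun _ => h1 2 one_lt_two) h2
  simpa only [one_mul] using h

theorem eventually_coeff_poincare_of_odd (n : ℕ) (hn : 3 ≤ n) (hpar : Odd n)
    (d : Fin (n-2) → ℕ) (hd : ∀ i, 0 < d i) (hd2 : ∀ i, 2 ∣ d i)
    (h1 : ∀ t : ℕ, 1 < t → (n - 1) / t ≤ (Finset.univ.filter fun i => 2 * t ∣ d i).card) :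
    ∀ᶠ m in Filter.atTop, PowerSeries.coeff m
      ((∏ i, (1 - PowerSeries.X ^ d i)) * PowerSeries.mk fun m => (hdim n m : ℚ)) = 0 := by
  choose D hD using hd2
  obtain rfl : d = fun i => 2 * D i := funext hD
  have hc : Fintype.card (Fin (n - 2)) + 2 = n := by
    rw [Fintype.card_fin]
    omega
  have hn2 := Nat.odd_iff.mp hpar
  have h := eventually_coeff_poincare n 2 n hn two_pos (mul_comm _ _) hc D
    (fun i => Nat.pos_of_mul_pos_left (hd i))
    fun j hj e he => div_add_div_le_card_filter n j _ e D hn hc he hj (Or.inl rfl)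
      (by simpa only [Nat.mul_dvd_mul_iff_left two_pos] using h1 e he)
      (fun hev => absurd hev (Nat.not_even_iff_odd.mpr hpar)) (fun h4 => by omega)
  have hdec : (PowerSeries.mk fun m => (hdim n (2 * m) : ℚ)) =
      decimate 2 (PowerSeries.mk fun m => (hdim n m : ℚ)) := by
    ext m
    rw [coeff_decimate, PowerSeries.coeff_mk, PowerSeries.coeff_mk]
  rw [hdec, ← decimate_prod_mul _ _ two_pos] at h
  obtain ⟨M, hM⟩ := Filter.eventually_atTop.mp h
  filter_upwards [Filter.eventually_ge_atTop (2 * M)] with m hm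
  rcases Nat.even_or_odd' m with ⟨k, rfl | rfl⟩
  · rw [← coeff_decimate]
    exact hM k (by omega)
  · refine coeff_prod_mul_of_odd _ _ _ (fun m hm => ?_) _ (odd_two_mul_add_one k)
    rw [PowerSeries.coeff_mk, hdim_of_odd n m (hpar.mul hm), Nat.cast_zero]

theorem stmt_7 (n : ℕ) (hn : 3 ≤ n) (d : Fin (n-2) → ℕ) (hd : ∀ i, 0 < d i)
    (hcond : ∀ t : ℕ, 1 < t →
      (Odd n → (∀ i, 2 ∣ d i) ∧
        (n - 1) / t ≤ (Finset.univ.filter fun i => 2 * t ∣ d i).card) ∧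
      (Even n → (n - 1) / t ≤ (Finset.univ.filter fun i => t ∣ d i).card ∧
        (n % 4 = 2 → n / 2 ≤ (Finset.univ.filter fun i => 2 ∣ d i).card))) :
    ∃ q : Polynomial ℤ,
      (PowerSeries.mk fun m => (hdim n m : ℤ)) *
        ∏ i : Fin (n-2), ((PowerSeries.X : PowerSeries ℤ) ^ d i - 1) = (q : PowerSeries ℤ) := by
  have key : ∀ᶠ m in Filter.atTop, PowerSeries.coeff m
      ((∏ i, (1 - PowerSeries.X ^ d i)) * PowerSeries.mk fun m => (hdim n m : ℚ)) = 0 := by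
    rcases Nat.even_or_odd n with hpar | hpar
    · exact eventually_coeff_poincare_of_even n hn hpar d hd
        (fun t ht => ((hcond t ht).2 hpar).1) ((hcond 2 one_lt_two).2 hpar).2
    · exact eventually_coeff_poincare_of_odd n hn hpar d hd
        ((hcond 2 one_lt_two).1 hpar).1 (fun t ht => ((hcond t ht).1 hpar).2)
  refine exists_polynomial_of_eventually_coeff_eq_zero _ ?_
  have hmap : PowerSeries.map (Int.castRingHom ℚ) ((PowerSeries.mk fun m => (hdim n m : ℤ)) *
      ∏ i : Fin (n-2), ((PowerSeries.X : PowerSeries ℤ) ^ d i - 1)) =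
      PowerSeries.C ((-1) ^ (n - 2)) * ((∏ i, (1 - PowerSeries.X ^ d i)) *
        PowerSeries.mk fun m => (hdim n m : ℚ)) := by
    have h1 : PowerSeries.map (Int.castRingHom ℚ) (PowerSeries.mk fun m => (hdim n m : ℤ)) =
        PowerSeries.mk fun m => (hdim n m : ℚ) := by
      ext m
      simp
    have h2 : (PowerSeries.C ((-1) ^ (n - 2)) : PowerSeries ℚ) =
        ∏ _i : Fin (n - 2), (-1 : PowerSeries ℚ) := by
      rw [Finset.prod_const, Finset.card_univ, Fintype.card_fin, map_pow, map_neg, map_one]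
    rw [map_mul, h1, map_prod, mul_comm, ← mul_assoc, h2, ← Finset.prod_mul_distrib]
    congr 1
    refine Finset.prod_congr rfl fun i _ => ?_
    rw [map_sub, map_pow, PowerSeries.map_X, map_one]
    ring
  filter_upwards [key] with m hm
  have h3 := congrArg (PowerSeries.coeff m) hmap
  rw [PowerSeries.coeff_C_mul, hm, mul_zero, PowerSeries.coeff_map, eq_intCast,
    Int.cast_eq_zero] at h3
  exact h3
end
end
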